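/- arXiv:2309.12724 — 2 statements merged into one kernel-verified Lean document; each statement's English description precedes it below -/
import Mathlib

section
/- For every positive integer p there exists a real algebraic integer λ_p > 1 (a root of a monic polynomial with integer coefficients) such that S_F^{(p)}(N) ≍ N^{(log λ_p)/(log φ)} as N → ∞. -/
/-- The Fibonacci sequence with `f 1 = 1`, `f 2 = 2`, `f (n+2) = f (n+1) + f n`
(the value at `0` is a dummy). -/
def fibS : ℕ → ℕ
  | 0 => 0
  | 1 => 1
  | 2 => 2
  | n + 3 => fibS (n + 2) + fibS (n + 1)

/-- `rF n` is the number of ways to write `n` as a sum of distinct Fibonacci numbers,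
i.e. the number of finite sets `S` of positive integers with `∑ i ∈ S, fibS i = n`. -/
noncomputable def rF (n : ℕ) : ℕ :=
  Nat.card {S : Finset ℕ // 0 ∉ S ∧ ∑ i ∈ S, fibS i = n}

/-- The power sum `S_F^{(p)}(N) = ∑_{n=0}^{N-1} (rF n)^p`. -/
noncomputable def SF (p N : ℕ) : ℕ :=
  ∑ n ∈ Finset.range N, (rF n) ^ p

/-- The golden ratio. -/
noncomputable def phi : ℝ := (1 + Real.sqrt 5) / 2

open scoped ENNReal

/-- Multiplication by the golden ratio on `ℤ[φ]`, where `(x, y)` stands for `x + y φ`. -/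
def goldenMul : (ℤ × ℤ) ≃+ (ℤ × ℤ) where
  toFun v := (v.2, v.1 + v.2)
  invFun v := (v.2 - v.1, v.1)
  left_inv v := by ext <;> simp
  right_inv v := by ext <;> simp
  map_add' v w := by ext <;> simp; ring

/-- The real embedding of `ℤ[φ]`. -/
noncomputable def goldenEmb : (ℤ × ℤ) →+ ℝ where
  toFun v := v.1 + v.2 * Real.goldenRatio
  map_zero' := by simp
  map_add' v w := by simp; ring

/-- The conjugate real embedding of `ℤ[φ]`. -/
noncomputable def goldenConjEmb : (ℤ × ℤ) →+ ℝ where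
  toFun v := v.1 + v.2 * Real.goldenConj
  map_zero' := by simp
  map_add' v w := by simp; ring

theorem goldenEmb_one : goldenEmb (1, 0) = 1 := by simp [goldenEmb]

theorem goldenConjEmb_one : goldenConjEmb (1, 0) = 1 := by simp [goldenConjEmb]

theorem goldenEmb_goldenMul (v : ℤ × ℤ) :
    goldenEmb (goldenMul v) = Real.goldenRatio * goldenEmb v := by
  have := Real.goldenRatio_sq
  simp only [goldenEmb, goldenMul, AddMonoidHom.coe_mk, ZeroHom.coe_mk, AddEquiv.coe_mk,
    Equiv.coe_fn_mk]
  push_cast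
  linear_combination -(v.2 : ℝ) * this

theorem goldenConjEmb_goldenMul (v : ℤ × ℤ) :
    goldenConjEmb (goldenMul v) = Real.goldenConj * goldenConjEmb v := by
  have := Real.goldenConj_sq
  simp only [goldenConjEmb, goldenMul, AddMonoidHom.coe_mk, ZeroHom.coe_mk, AddEquiv.coe_mk,
    Equiv.coe_fn_mk]
  push_cast
  linear_combination -(v.2 : ℝ) * this

theorem goldenEmb_iterate_goldenMul (m : ℕ) (v : ℤ × ℤ) :
    goldenEmb (goldenMul^[m] v) = Real.goldenRatio ^ m * goldenEmb v := by
  induction m with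
  | zero => simp
  | succ m ih => rw [Function.iterate_succ_apply', goldenEmb_goldenMul, ih, pow_succ']; ring

theorem lt_goldenRatio : (1.6 : ℝ) < Real.goldenRatio := by
  nlinarith [Real.goldenRatio_sq, Real.one_lt_goldenRatio]

theorem goldenRatio_lt : Real.goldenRatio < (1.62 : ℝ) := by
  nlinarith [Real.goldenRatio_sq, Real.one_lt_goldenRatio]

/-- Elements of `ℤ[φ]` both of whose embeddings are at most `4` in absolute value. -/
def goldenBox : Set (ℤ × ℤ) := {v | |goldenEmb v| ≤ 4 ∧ |goldenConjEmb v| ≤ 4}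

theorem goldenBox_finite : goldenBox.Finite := by
  refine (Set.finite_Icc ((-20, -20) : ℤ × ℤ) (20, 20)).subset fun v hv => ?_
  obtain ⟨h1, h2⟩ := hv
  simp only [goldenEmb, goldenConjEmb, AddMonoidHom.coe_mk, ZeroHom.coe_mk, abs_le] at h1 h2
  have hs := Real.goldenRatio_add_goldenConj
  have h3 := lt_goldenRatio
  have h4 := goldenRatio_lt
  have hc : Real.goldenConj = 1 - Real.goldenRatio := by linarith
  rw [hc] at h2
  have hy1 : (v.2 : ℝ) ≤ 4 := by nlinarith
  have hy2 : (-4 : ℝ) ≤ v.2 := by nlinarith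
  have hx1 : (v.1 : ℝ) ≤ 20 := by nlinarith
  have hx2 : (-20 : ℝ) ≤ v.1 := by nlinarith
  have hy1' : v.2 ≤ 4 := by exact_mod_cast hy1
  have hy2' : -4 ≤ v.2 := by exact_mod_cast hy2
  have hx1' : v.1 ≤ 20 := by exact_mod_cast hx1
  have hx2' : -20 ≤ v.1 := by exact_mod_cast hx2
  simp only [Set.mem_Icc, Prod.le_def]
  omega

/-- The number of words `ε ∈ {0, 1}^m` with `∑ i < m, ε i * φ ^ i = v`. -/
noncomputable def goldenCount : ℕ → ℤ × ℤ → ℝ≥0∞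
  | 0, v => if v = 0 then 1 else 0
  | m + 1, v => goldenCount m (goldenMul.symm v) + goldenCount m (goldenMul.symm (v - (1, 0)))

theorem goldenCount_support (m : ℕ) (v : ℤ × ℤ) (h : goldenCount m v ≠ 0) :
    (-1 < goldenConjEmb v ∧ goldenConjEmb v < Real.goldenRatio) ∧
      (0 ≤ goldenEmb v ∧ goldenEmb v ≤ 2 * (Real.goldenRatio ^ m - 1)) := by
  have hs := Real.goldenRatio_add_goldenConj
  have hm := Real.goldenRatio_mul_goldenConj
  have h3 := lt_goldenRatio
  have h4 := goldenRatio_lt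
  induction m generalizing v with
  | zero =>
    have : v = 0 := by by_contra hv; exact h (by simp [goldenCount, hv])
    subst this
    simp only [map_zero, pow_zero, sub_self, mul_zero]
    exact ⟨⟨by norm_num, by linarith⟩, le_rfl, le_rfl⟩
  | succ m ih =>
    rw [goldenCount] at h
    have key : ∀ w : ℤ × ℤ, ∀ ε : ℝ, 0 ≤ ε → ε ≤ 1 → goldenCount m w ≠ 0 →
        goldenConjEmb v = goldenConjEmb (goldenMul w) + ε →
        goldenEmb v = goldenEmb (goldenMul w) + ε →
        (-1 < goldenConjEmb v ∧ goldenConjEmb v < Real.goldenRatio) ∧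
      (0 ≤ goldenEmb v ∧ goldenEmb v ≤ 2 * (Real.goldenRatio ^ (m + 1) - 1)) := by
      intro w ε h0 h1 hw hc he
      obtain ⟨⟨i1, i2⟩, i3, i4⟩ := ih w hw
      rw [hc, he, goldenEmb_goldenMul, goldenConjEmb_goldenMul, pow_succ']
      have hψ : Real.goldenConj < 0 := by linarith
      refine ⟨⟨?_, ?_⟩, ?_, ?_⟩ <;> nlinarith
    by_cases h0 : goldenCount m (goldenMul.symm v) = 0
    · rw [h0, zero_add] at h
      refine key _ 1 zero_le_one le_rfl h ?_ ?_ <;>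
        simp [goldenConjEmb_one, goldenEmb_one]
    · exact key _ 0 le_rfl zero_le_one h0 (by simp) (by simp)

theorem goldenCount_add (m n : ℕ) (v : ℤ × ℤ) :
    goldenCount (m + n) v = ∑' h, goldenCount n h * goldenCount m (v - goldenMul^[m] h) := by
  induction m generalizing v with
  | zero =>
    rw [tsum_eq_single v]
    · simp [goldenCount]
    · intro w hw
      simp [goldenCount, sub_eq_zero, hw.symm]
  | succ m ih =>
    rw [show m + 1 + n = m + n + 1 by ring, goldenCount, ih, ih, ← ENNReal.tsum_add]
    refine tsum_congr fun h => ?_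
    rw [goldenCount, mul_add, Function.iterate_succ_apply']
    simp only [map_sub, AddEquiv.symm_apply_apply]
    rw [sub_right_comm]

theorem goldenCount_succ (m : ℕ) (v : ℤ × ℤ) :
    goldenCount (m + 1) v = goldenCount m v + goldenCount m (v - goldenMul^[m] (1, 0)) := by
  have h1 : ∀ h, goldenCount 1 h = (if h = 0 then 1 else 0) + if h = (1, 0) then 1 else 0 := by
    intro h
    simp [goldenCount, sub_eq_zero]
  rw [goldenCount_add]
  simp only [h1, add_mul, ite_mul, one_mul, zero_mul]
  rw [ENNReal.tsum_add, tsum_ite_eq, tsum_ite_eq]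
  simp [iterate_map_zero]

theorem one_le_goldenCount_zero (m : ℕ) : 1 ≤ goldenCount m 0 := by
  induction m with
  | zero => simp [goldenCount]
  | succ m ih =>
    rw [goldenCount, map_zero]
    exact ih.trans le_self_add

/-- The `p`-th moment of `goldenCount m`. -/
noncomputable def goldenMoment (p m : ℕ) : ℝ≥0∞ := ∑' v, goldenCount m v ^ p

/-- The correlation of `goldenCount m` along the tuple of shifts `D`. -/
noncomputable def goldenCorr {ι : Type*} [Fintype ι] (m : ℕ) (D : ι → ℤ × ℤ) : ℝ≥0∞ :=
  ∑' v, ∏ j, goldenCount m (v + D j)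

theorem goldenCorr_zero_right (p m : ℕ) : goldenCorr m (0 : Fin p → ℤ × ℤ) = goldenMoment p m := by
  simp [goldenCorr, goldenMoment]

/-- The pair `(0, 0)` or `(1, 0)`, i.e. the digit `0` or `1` in `ℤ[φ]`. -/
def goldenDigit (b : Bool) : ℤ × ℤ := if b then (1, 0) else 0

/-- The differences of the quotients by `φ` after removing the lowest digits `ε`. -/
def goldenStep {ι : Type*} (j₀ : ι) (D : ι → ℤ × ℤ) (ε : ι → Bool) (j : ι) : ℤ × ℤ :=
  goldenMul.symm (D j - goldenDigit (ε j)) - goldenMul.symm (D j₀ - goldenDigit (ε j₀))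

theorem goldenCorr_succ {ι : Type*} [Fintype ι] [DecidableEq ι] (j₀ : ι) (m : ℕ) (D : ι → ℤ × ℤ) :
    goldenCorr (m + 1) D = ∑ ε : ι → Bool, goldenCorr m (goldenStep j₀ D ε) := by
  have h1 : ∀ v, goldenCount (m + 1) v =
      ∑ b, goldenCount m (goldenMul.symm (v - goldenDigit b)) := by
    intro v
    simp [goldenCount, goldenDigit, add_comm]
  simp only [goldenCorr, h1, Finset.prod_univ_sum, Fintype.piFinset_univ]
  rw [Summable.tsum_finsetSum fun _ _ => ENNReal.summable]
  refine Finset.sum_congr rfl fun ε _ => ?_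
  refine Eq.trans ?_ ((goldenMul.symm.toEquiv.trans
    (Equiv.addRight (goldenMul.symm (D j₀ - goldenDigit (ε j₀))))).tsum_eq _)
  refine tsum_congr fun v => Finset.prod_congr rfl fun j _ => ?_
  simp only [goldenStep, Equiv.trans_apply, Equiv.coe_addRight, AddEquiv.toEquiv_eq_coe,
    AddEquiv.coe_toEquiv, map_sub, map_add]
  congr 1
  abel

theorem goldenCorr_ne_top {ι : Type*} [Fintype ι] [DecidableEq ι] (j₀ : ι) (m : ℕ) (D : ι → ℤ × ℤ) :
    goldenCorr m D ≠ ⊤ := by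
  induction m generalizing D with
  | zero =>
    have h : goldenCorr 0 D ≤ ∑' v, if v = -D j₀ then 1 else 0 := by
      refine ENNReal.tsum_le_tsum fun v => ?_
      split_ifs with hv
      · exact Finset.prod_le_one' fun j _ => by rw [goldenCount]; split_ifs <;> simp
      · rw [Finset.prod_eq_zero (Finset.mem_univ j₀)]
        simp [goldenCount, add_eq_zero_iff_eq_neg, hv]
    rw [tsum_ite_eq] at h
    exact ne_top_of_le_ne_top ENNReal.one_ne_top h
  | succ m ih =>
    rw [goldenCorr_succ j₀]
    exact ENNReal.sum_ne_top.2 fun ε _ => ih _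

theorem goldenMoment_ne_top {p : ℕ} (hp : 0 < p) (m : ℕ) : goldenMoment p m ≠ ⊤ := by
  rw [← goldenCorr_zero_right]
  exact goldenCorr_ne_top ⟨0, hp⟩ m _

theorem goldenStep_mem {ι : Type*} [Fintype ι] {j₀ : ι} {m : ℕ} {D : ι → ℤ × ℤ} {ε : ι → Bool}
    (hD : ∀ j, D j ∈ goldenBox) (hD₀ : D j₀ = 0) (h : goldenCorr m (goldenStep j₀ D ε) ≠ 0)
    (j : ι) : goldenStep j₀ D ε j ∈ goldenBox := by
  have h3 := lt_goldenRatio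
  have h4 := goldenRatio_lt
  constructor
  · have h5 : Real.goldenRatio * goldenEmb (goldenStep j₀ D ε j) =
        goldenEmb (D j) - goldenEmb (goldenDigit (ε j)) + goldenEmb (goldenDigit (ε j₀)) := by
      rw [← goldenEmb_goldenMul]
      simp [goldenStep, hD₀]
    have h6 := abs_le.1 (hD j).1
    have h7 : ∀ b, 0 ≤ goldenEmb (goldenDigit b) ∧ goldenEmb (goldenDigit b) ≤ 1 := by
      intro b
      cases b <;> simp [goldenDigit, goldenEmb_one]
    have h8 := h7 (ε j)
    have h9 := h7 (ε j₀)
    rw [abs_le]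
    constructor <;> nlinarith
  · obtain ⟨v, hv⟩ : ∃ v, ∏ i, goldenCount m (v + goldenStep j₀ D ε i) ≠ 0 := by
      by_contra! hv
      exact h (by simp [goldenCorr, hv])
    rw [Finset.prod_ne_zero_iff] at hv
    have h5 := (goldenCount_support m _ (hv j (Finset.mem_univ j))).1
    have h6 := (goldenCount_support m _ (hv j₀ (Finset.mem_univ j₀))).1
    have h7 : goldenStep j₀ D ε j₀ = 0 := by simp [goldenStep]
    rw [h7, add_zero] at h6
    rw [map_add] at h5
    rw [abs_le]
    constructor <;> linarith

theorem exists_monic_recurrence_of_mulVec {S : Type*} [Fintype S] (A : Matrix S S ℤ)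
    (u : ℕ → S → ℝ) (h : ∀ m, u (m + 1) = (A.map (Int.cast : ℤ → ℝ)).mulVec (u m)) :
    ∃ P : Polynomial ℤ, P.Monic ∧ ∀ m s,
      ∑ k ∈ Finset.range (P.natDegree + 1), (P.coeff k : ℝ) * u (m + k) s = 0 := by
  classical
  refine ⟨A.charpoly, A.charpoly_monic, fun m s => ?_⟩
  set B := A.map (Int.cast : ℤ → ℝ) with hB
  have h1 : ∀ k, u (m + k) = (B ^ k).mulVec (u m) := by
    intro k
    induction k with
    | zero => simp
    | succ k ih => rw [← add_assoc, h, ih, Matrix.mulVec_mulVec, pow_succ']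
  have h2 : Polynomial.aeval B A.charpoly = 0 := by
    have h3 := B.aeval_self_charpoly
    have h4 : B.charpoly = A.charpoly.map (algebraMap ℤ ℝ) := (A.charpoly_map (algebraMap ℤ ℝ))
    rwa [h4, Polynomial.aeval_map_algebraMap] at h3
  rw [Polynomial.aeval_eq_sum_range] at h2
  have h5 := congrFun (congrArg (fun M => M.mulVec (u m)) h2) s
  simp only [Matrix.zero_mulVec, Matrix.sum_mulVec, Finset.sum_apply] at h5
  refine Eq.trans ?_ h5
  refine Finset.sum_congr rfl fun k _ => ?_
  rw [h1, ← zsmul_eq_mul, Matrix.smul_mulVec, Pi.smul_apply]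

theorem goldenMoment_recurrence {p : ℕ} (hp : 0 < p) :
    ∃ P : Polynomial ℤ, P.Monic ∧ ∀ m,
      ∑ k ∈ Finset.range (P.natDegree + 1),
        (P.coeff k : ℝ) * (goldenMoment p (m + k)).toReal = 0 := by
  classical
  set j₀ : Fin p := ⟨0, hp⟩
  let T : Set (Fin p → ℤ × ℤ) := {D | (∀ j, D j ∈ goldenBox) ∧ D j₀ = 0}
  have hT : T.Finite :=
    (Set.Finite.pi' fun _ : Fin p => goldenBox_finite).subset fun D hD => hD.1
  have : Fintype T := hT.fintype
  let A : Matrix T T ℤ := Matrix.of fun D D' =>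
    ∑ ε : Fin p → Bool, if goldenStep j₀ D.1 ε = D'.1 then 1 else 0
  obtain ⟨P, hP, hrec⟩ := exists_monic_recurrence_of_mulVec A
    (fun m D => (goldenCorr m D.1).toReal) (by
      intro m
      ext D
      simp only [Matrix.mulVec, dotProduct, Matrix.map_apply, Matrix.of_apply, A]
      push_cast
      rw [goldenCorr_succ j₀, ENNReal.toReal_sum fun ε _ => goldenCorr_ne_top j₀ m _]
      simp only [Finset.sum_mul]
      rw [Finset.sum_comm]
      refine Finset.sum_congr rfl fun ε _ => ?_
      by_cases hε : goldenStep j₀ D.1 ε ∈ T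
      · rw [Finset.sum_eq_single ⟨_, hε⟩]
        · simp
        · intro D' _ hD'
          rw [if_neg, zero_mul]
          exact fun h => hD' (Subtype.ext h.symm)
        · simp
      · have h0 : goldenCorr m (goldenStep j₀ D.1 ε) = 0 := by
          by_contra h
          exact hε ⟨goldenStep_mem D.2.1 D.2.2 h, by simp [goldenStep]⟩
        rw [h0, Finset.sum_eq_zero]
        · simp
        · intro D' _
          rw [if_neg, zero_mul]
          exact fun h => hε (h ▸ D'.2))
  refine ⟨P, hP, fun m => ?_⟩
  have h0 : (0 : Fin p → ℤ × ℤ) ∈ T := ⟨fun j => by simp [goldenBox], rfl⟩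
  simpa only [goldenCorr_zero_right] using hrec m ⟨0, h0⟩

theorem ENNReal.tsum_pow_le_pow_tsum {α : Type*} (a : α → ℝ≥0∞) {p : ℕ} (hp : 0 < p) :
    ∑' x, a x ^ p ≤ (∑' x, a x) ^ p := by
  obtain ⟨q, rfl⟩ := Nat.exists_eq_succ_of_ne_zero hp.ne'
  calc ∑' x, a x ^ (q + 1) ≤ ∑' x, (∑' y, a y) ^ q * a x :=
        ENNReal.tsum_le_tsum fun x => by
          rw [pow_succ]
          gcongr
          exact ENNReal.le_tsum x
    _ = (∑' x, a x) ^ (q + 1) := by rw [ENNReal.tsum_mul_left, pow_succ]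

theorem ENNReal.pow_tsum_le_of_support {α : Type*} (a : α → ℝ≥0∞) {p : ℕ} (hp : 0 < p)
    (s : Finset α) (hs : ∀ x ∉ s, a x = 0) :
    (∑' x, a x) ^ p ≤ (s.card : ℝ≥0∞) ^ p * ∑' x, a x ^ p := by
  rw [tsum_eq_sum hs]
  rcases s.eq_empty_or_nonempty with rfl | hne
  · simp [hp.ne']
  obtain ⟨x, -, hx⟩ := s.exists_max_image a hne
  calc (∑ y ∈ s, a y) ^ p ≤ (s.card * a x) ^ p := by
        gcongr
        simpa using Finset.sum_le_card_nsmul s a (a x) hx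
    _ = (s.card : ℝ≥0∞) ^ p * a x ^ p := mul_pow _ _ _
    _ ≤ _ := by
        gcongr
        exact ENNReal.le_tsum (f := fun x => a x ^ p) x

theorem isIntegral_of_recurrence_of_geometric_bounds {t : ℕ → ℝ} {lam c C : ℝ} (hlam : 0 < lam)
    (hc : 0 < c) (hl : ∀ m, c * lam ^ m ≤ t m) (hu : ∀ m, t m ≤ C * lam ^ m)
    {P : Polynomial ℤ} (hP : P.Monic)
    (hrec : ∀ m, ∑ k ∈ Finset.range (P.natDegree + 1), (P.coeff k : ℝ) * t (m + k) = 0) :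
    IsIntegral ℤ lam := by
  refine ⟨P, hP, ?_⟩
  set s : ℕ → ℝ := fun m => t m / lam ^ m with hs
  have hsl : ∀ m, c ≤ s m := fun m => (le_div_iff₀ (by positivity)).2 (hl m)
  have hsu : ∀ m, s m ≤ C := fun m => (div_le_iff₀ (by positivity)).2 (hu m)
  have hrec' : ∀ m, ∑ k ∈ Finset.range (P.natDegree + 1),
      (P.coeff k : ℝ) * lam ^ k * s (m + k) = 0 := by
    intro m
    have := congrArg (· / lam ^ m) (hrec m)
    simp only [Finset.sum_div, zero_div] at this
    rw [← this]
    refine Finset.sum_congr rfl fun k _ => ?_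
    simp only [hs, pow_add]
    field_simp
  have hsum : ∀ k M, |∑ m ∈ Finset.range M, s (m + k) - ∑ m ∈ Finset.range M, s m| ≤ k * C := by
    intro k M
    have h1 : ∑ m ∈ Finset.range M, s (m + k) - ∑ m ∈ Finset.range M, s m =
        ∑ m ∈ Finset.range k, s (m + M) - ∑ m ∈ Finset.range k, s m := by
      have e1 := Finset.sum_range_add s k M
      have e2 := Finset.sum_range_add s M k
      rw [add_comm M k] at e2
      simp only [add_comm _ k, add_comm _ M]
      linarith
    rw [h1, ← Finset.sum_sub_distrib]
    refine (Finset.abs_sum_le_sum_abs _ _).trans ?_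
    have := Finset.sum_le_card_nsmul (Finset.range k) (fun m => |s (m + M) - s m|) C fun m _ => by
      rw [abs_le]
      constructor <;> linarith [hsl m, hsu m, hsl (m + M), hsu (m + M)]
    simpa using this
  set Q : ℝ := ∑ k ∈ Finset.range (P.natDegree + 1), (P.coeff k : ℝ) * lam ^ k with hQ
  set K : ℝ := ∑ k ∈ Finset.range (P.natDegree + 1), |(P.coeff k : ℝ) * lam ^ k| * (k * C) with hK
  have hbound : ∀ M : ℕ, |Q| * (M * c) ≤ K := by
    intro M
    have h1 : ∑ k ∈ Finset.range (P.natDegree + 1), (P.coeff k : ℝ) * lam ^ k *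
        (∑ m ∈ Finset.range M, s (m + k)) = 0 := by
      simp only [Finset.mul_sum]
      rw [Finset.sum_comm]
      exact Finset.sum_eq_zero fun m _ => hrec' m
    have h2 : Q * ∑ m ∈ Finset.range M, s m =
        -∑ k ∈ Finset.range (P.natDegree + 1), (P.coeff k : ℝ) * lam ^ k *
        (∑ m ∈ Finset.range M, s (m + k) - ∑ m ∈ Finset.range M, s m) := by
      simp only [mul_sub, Finset.sum_sub_distrib, h1, hQ, Finset.sum_mul]
      ring
    have h3 : (M : ℝ) * c ≤ ∑ m ∈ Finset.range M, s m := by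
      simpa using Finset.card_nsmul_le_sum (Finset.range M) s c fun m _ => hsl m
    calc |Q| * (M * c) ≤ |Q| * |∑ m ∈ Finset.range M, s m| := by
          gcongr
          exact h3.trans (le_abs_self _)
      _ = |∑ k ∈ Finset.range (P.natDegree + 1), (P.coeff k : ℝ) * lam ^ k *
        (∑ m ∈ Finset.range M, s (m + k) - ∑ m ∈ Finset.range M, s m)| := by
          rw [← abs_mul, h2, abs_neg]
      _ ≤ K := by
          refine (Finset.abs_sum_le_sum_abs _ _).trans (Finset.sum_le_sum fun k _ => ?_)
          rw [abs_mul]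
          gcongr
          exact hsum k M
  have hQ0 : Q = 0 := by
    by_contra h
    have hpos : 0 < |Q| * c := mul_pos (abs_pos.2 h) hc
    obtain ⟨M, hM⟩ := exists_nat_gt (K / (|Q| * c))
    rw [div_lt_iff₀ hpos] at hM
    linarith [hbound M]
  rw [Polynomial.eval₂_eq_sum_range]
  simpa [hQ] using hQ0

theorem exists_geometric_bounds_of_quasi_mul {t : ℕ → ℝ} {K : ℝ} (h1 : ∀ m, 1 ≤ t m)
    (hsup : ∀ m n, t m * t n ≤ t (m + n)) (hsub : ∀ m n, t (m + n) ≤ K * (t m * t n)) :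
    ∃ lam : ℝ, 0 < lam ∧ 0 < K ∧ ∀ m, t m ≤ lam ^ m ∧ lam ^ m ≤ K * t m := by
  have hK : 1 ≤ K := by
    have := hsup 0 0
    have := hsub 0 0
    have := h1 0
    by_contra! hK
    nlinarith [mul_pos (show 0 < t 0 by linarith) (show 0 < t 0 by linarith)]
  have hpos : ∀ m, 0 < t m := fun m => zero_lt_one.trans_le (h1 m)
  set u : ℕ → ℝ := fun m => Real.log (K * t m) with hu
  have hu0 : ∀ m, 0 ≤ u m := fun m => Real.log_nonneg (one_le_mul_of_one_le_of_one_le hK (h1 m))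
  have hsubadd : Subadditive u := by
    intro m n
    have := hpos m
    have := hpos n
    have := hpos (m + n)
    simp only [hu]
    rw [← Real.log_mul (by positivity) (by positivity)]
    refine Real.log_le_log (by positivity) ?_
    calc K * t (m + n) ≤ K * (K * (t m * t n)) := by gcongr; exact hsub m n
      _ = _ := by ring
  have hbdd : BddBelow (Set.range fun n => u n / n) :=
    ⟨0, by rintro _ ⟨n, rfl⟩; exact div_nonneg (hu0 n) n.cast_nonneg⟩
  have hpow : ∀ m k, t m ^ (k + 1) ≤ t ((k + 1) * m) := by
    intro m k
    induction k with
    | zero => simp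
    | succ k ih =>
      calc t m ^ (k + 1 + 1) = t m ^ (k + 1) * t m := pow_succ _ _
        _ ≤ t ((k + 1) * m) * t m := by gcongr; exact (hpos m).le
        _ ≤ _ := (hsup _ _).trans (by rw [← Nat.succ_mul])
  have ht0 : t 0 = 1 := by
    have := hsup 0 0
    have := h1 0
    simp only [add_zero] at *
    nlinarith
  refine ⟨Real.exp hsubadd.lim, Real.exp_pos _, by linarith, fun m => ?_⟩
  rcases Nat.eq_zero_or_pos m with rfl | hm
  · simp [ht0, hK]
  have hm' : (0 : ℝ) < m := by exact_mod_cast hm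
  rw [← Real.exp_nat_mul]
  constructor
  · rw [← Real.log_le_iff_le_exp (hpos m), ← div_le_iff₀' hm']
    have htend := (hsubadd.tendsto_lim hbdd).comp
      (((Filter.tendsto_add_atTop_nat 1).atTop_mul_const' hm))
    refine ge_of_tendsto' htend fun k => ?_
    simp only [Function.comp]
    rw [div_le_div_iff₀ hm' (by positivity)]
    have h2 : ((k + 1 : ℕ) : ℝ) * Real.log (t m) ≤ u ((k + 1) * m) := by
      rw [← Real.log_pow]
      have := hpos m
      refine Real.log_le_log (by positivity) ((hpow m k).trans ?_)
      have := hpos ((k + 1) * m)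
      nlinarith
    push_cast at h2 ⊢
    nlinarith
  · have := hpos m
    rw [← Real.le_log_iff_exp_le (by positivity), ← le_div_iff₀' hm']
    exact hsubadd.lim_le_div hbdd hm.ne'

theorem tsum_tsum_goldenCount_conv (p m n : ℕ) :
    ∑' v, ∑' h, (goldenCount n h * goldenCount m (v - goldenMul^[m] h)) ^ p =
      goldenMoment p m * goldenMoment p n := by
  rw [ENNReal.tsum_comm, goldenMoment, goldenMoment, ← ENNReal.tsum_mul_left]
  refine tsum_congr fun h => ?_
  simp only [mul_pow]
  rw [ENNReal.tsum_mul_left, mul_comm]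
  congr 1
  exact (Equiv.subRight (goldenMul^[m] h)).tsum_eq fun v => goldenCount m v ^ p

theorem goldenMoment_mul_le {p : ℕ} (hp : 0 < p) (m n : ℕ) :
    goldenMoment p m * goldenMoment p n ≤ goldenMoment p (m + n) := by
  rw [← tsum_tsum_goldenCount_conv, goldenMoment]
  refine ENNReal.tsum_le_tsum fun v => ?_
  rw [goldenCount_add]
  exact ENNReal.tsum_pow_le_pow_tsum _ hp

theorem sub_mem_goldenBox {m n : ℕ} {v h h' : ℤ × ℤ}
    (hh : goldenCount n h * goldenCount m (v - goldenMul^[m] h) ≠ 0)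
    (hh' : goldenCount n h' * goldenCount m (v - goldenMul^[m] h') ≠ 0) :
    h - h' ∈ goldenBox := by
  have h3 := goldenRatio_lt
  obtain ⟨a1, a2⟩ := (goldenCount_support n h (left_ne_zero_of_mul hh)).1
  obtain ⟨b1, b2⟩ := (goldenCount_support n h' (left_ne_zero_of_mul hh')).1
  obtain ⟨a3, a4⟩ := (goldenCount_support m _ (right_ne_zero_of_mul hh)).2
  obtain ⟨b3, b4⟩ := (goldenCount_support m _ (right_ne_zero_of_mul hh')).2
  rw [map_sub, goldenEmb_iterate_goldenMul] at a3 a4 b3 b4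
  have hg : 0 < Real.goldenRatio ^ m := pow_pos Real.goldenRatio_pos m
  constructor <;> rw [map_sub, abs_le]
  · constructor
    · refine le_of_mul_le_mul_left ?_ hg
      linarith
    · refine le_of_mul_le_mul_left ?_ hg
      linarith
  · constructor <;> linarith

theorem goldenMoment_add_le {p : ℕ} (hp : 0 < p) (m n : ℕ) :
    goldenMoment p (m + n) ≤ (goldenBox_finite.toFinset.card : ℝ≥0∞) ^ p *
      (goldenMoment p m * goldenMoment p n) := by
  classical
  rw [← tsum_tsum_goldenCount_conv, goldenMoment, ← ENNReal.tsum_mul_left]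
  refine ENNReal.tsum_le_tsum fun v => ?_
  rw [goldenCount_add]
  by_cases hv : ∃ h₀, goldenCount n h₀ * goldenCount m (v - goldenMul^[m] h₀) ≠ 0
  · obtain ⟨h₀, hh₀⟩ := hv
    rw [← Finset.card_image_of_injective _ (add_left_injective h₀)]
    refine ENNReal.pow_tsum_le_of_support _ hp _ fun h hh => ?_
    by_contra hne
    refine hh (Finset.mem_image.2 ⟨h - h₀, ?_, sub_add_cancel _ _⟩)
    exact goldenBox_finite.mem_toFinset.2 (sub_mem_goldenBox hne hh₀)
  · push Not at hv
    simp [hv, hp.ne']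

theorem one_le_goldenMoment (p m : ℕ) : 1 ≤ goldenMoment p m :=
  (one_le_pow₀ (one_le_goldenCount_zero m)).trans
    (ENNReal.le_tsum (f := fun v => goldenCount m v ^ p) 0)

theorem two_le_goldenMoment_one (p : ℕ) : 2 ≤ goldenMoment p 1 := by
  refine le_trans ?_ (ENNReal.sum_le_tsum {(0 : ℤ × ℤ), ((1, 0) : ℤ × ℤ)})
  rw [Finset.sum_pair (by decide)]
  simp only [goldenCount]
  norm_num [one_add_one_eq_two]

/-- The integer value of an element of `ℤ[φ]` when `φ ^ i` is replaced by `fibS (i + 1)`. -/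
def fibVal : (ℤ × ℤ) →+ ℤ where
  toFun v := v.1 + 2 * v.2
  map_zero' := by simp
  map_add' v w := by simp; ring

theorem fibVal_iterate_goldenMul (m : ℕ) :
    fibVal (goldenMul^[m] (1, 0)) = fibS (m + 1) := by
  induction m using Nat.twoStepInduction with
  | zero => simp [fibVal, fibS]
  | one => simp [fibVal, fibS, goldenMul]
  | more m h1 h2 =>
    rw [Function.iterate_succ_apply'] at h2
    rw [Function.iterate_succ_apply', Function.iterate_succ_apply', fibS]
    push_cast
    rw [← h1, ← h2]
    simp only [fibVal, goldenMul, AddMonoidHom.coe_mk, ZeroHom.coe_mk, AddEquiv.coe_mk,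
      Equiv.coe_fn_mk]
    ring

theorem fibVal_sum_iterate_goldenMul {m : ℕ} {S : Finset ℕ}
    (hS : S ∈ (Finset.Icc 1 m).powerset) :
    fibVal (∑ i ∈ S, goldenMul^[i - 1] (1, 0)) = ((∑ i ∈ S, fibS i : ℕ) : ℤ) := by
  rw [map_sum]
  push_cast
  refine Finset.sum_congr rfl fun i hi => ?_
  have := (Finset.mem_Icc.1 (Finset.mem_powerset.1 hS hi)).1
  rw [fibVal_iterate_goldenMul, Nat.sub_add_cancel this]

theorem eq_of_fibVal_eq {m : ℕ} {v w : ℤ × ℤ} (hv : goldenCount m v ≠ 0)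
    (hw : goldenCount m w ≠ 0) (h : fibVal v = fibVal w) : v = w := by
  obtain ⟨a1, a2⟩ := (goldenCount_support m v hv).1
  obtain ⟨b1, b2⟩ := (goldenCount_support m w hw).1
  have h3 := lt_goldenRatio
  simp only [goldenConjEmb, fibVal, AddMonoidHom.coe_mk, ZeroHom.coe_mk] at *
  rw [← Real.one_sub_goldenConj] at *
  have hx : (v.1 : ℝ) + 2 * v.2 = w.1 + 2 * w.2 := by exact_mod_cast h
  have hlt : (v.2 : ℝ) < w.2 + 1 := by nlinarith
  have hgt : (w.2 : ℝ) < v.2 + 1 := by nlinarith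
  have hlt' : v.2 < w.2 + 1 := by exact_mod_cast hlt
  have hgt' : w.2 < v.2 + 1 := by exact_mod_cast hgt
  ext <;> omega

theorem sum_powerset_Icc_eq_tsum_goldenCount (m : ℕ) (g : ℤ × ℤ → ℝ≥0∞) :
    ∑ S ∈ (Finset.Icc 1 m).powerset, g (∑ i ∈ S, goldenMul^[i - 1] (1, 0)) =
      ∑' v, goldenCount m v * g v := by
  induction m generalizing g with
  | zero =>
    rw [tsum_eq_single 0 fun v hv => by simp [goldenCount, hv]]
    simp [goldenCount]
  | succ m ih =>
    have hI : Finset.Icc 1 (m + 1) = insert (m + 1) (Finset.Icc 1 m) := by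
      ext i
      simp only [Finset.mem_Icc, Finset.mem_insert]
      omega
    have hm : m + 1 ∉ Finset.Icc 1 m := by simp
    rw [hI, Finset.sum_powerset_insert hm, ih g]
    have h1 : ∀ S ∈ (Finset.Icc 1 m).powerset,
        g (∑ i ∈ insert (m + 1) S, goldenMul^[i - 1] (1, 0)) =
          g (∑ i ∈ S, goldenMul^[i - 1] (1, 0) + goldenMul^[m] (1, 0)) := by
      intro S hS
      rw [Finset.sum_insert fun h => hm (Finset.mem_powerset.1 hS h), add_comm,
        Nat.add_sub_cancel]
    rw [Finset.sum_congr rfl h1, ih fun v => g (v + goldenMul^[m] (1, 0))]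
    simp only [goldenCount_succ, add_mul]
    rw [ENNReal.tsum_add]
    congr 1
    rw [← (Equiv.subRight (goldenMul^[m] ((1, 0) : ℤ × ℤ))).tsum_eq]
    simp

/-- The number of subsets of `{1, …, m}` whose Fibonacci numbers sum to `n`. -/
def fibCount (m n : ℕ) : ℕ :=
  ((Finset.Icc 1 m).powerset.filter fun S => ∑ i ∈ S, fibS i = n).card

theorem fibCount_eq_tsum (m n : ℕ) :
    (fibCount m n : ℝ≥0∞) = ∑' v, if fibVal v = n then goldenCount m v else 0 := by
  have h := sum_powerset_Icc_eq_tsum_goldenCount m fun v => if fibVal v = n then 1 else 0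
  simp only [mul_ite, mul_one, mul_zero] at h
  rw [← h, fibCount, Finset.card_filter]
  push_cast
  refine Finset.sum_congr rfl fun S hS => ?_
  rw [fibVal_sum_iterate_goldenMul hS]
  simp only [Nat.cast_inj]

theorem fibCount_pow_eq_tsum {p : ℕ} (hp : 0 < p) (m n : ℕ) :
    (fibCount m n : ℝ≥0∞) ^ p = ∑' v, if fibVal v = n then goldenCount m v ^ p else 0 := by
  rw [fibCount_eq_tsum]
  by_cases h : ∃ w, fibVal w = n ∧ goldenCount m w ≠ 0
  · obtain ⟨w, hw, hw0⟩ := h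
    rw [tsum_eq_single w, tsum_eq_single w, if_pos hw, if_pos hw]
    all_goals
      intro v hv
      split_ifs with hvn
      · by_contra h0
        refine hv (eq_of_fibVal_eq (fun h1 => h0 ?_) hw0 (hvn.trans hw.symm))
        simp [h1, hp.ne']
      · rfl
  · push Not at h
    have h1 : ∀ v, (if fibVal v = n then goldenCount m v else 0) = 0 := fun v => by
      split_ifs with hv
      · exact h v hv
      · rfl
    have h2 : ∀ v, (if fibVal v = n then goldenCount m v ^ p else 0) = 0 := fun v => by
      split_ifs with hv
      · simp [h v hv, hp.ne']
      · rfl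
    simp [h1, h2, hp.ne']

theorem fibS_lt_fibS_succ (n : ℕ) : fibS n < fibS (n + 1) := by
  induction n using Nat.twoStepInduction with
  | zero => simp [fibS]
  | one => simp [fibS]
  | more n h1 h2 =>
    rw [show fibS (n + 2 + 1) = fibS (n + 2) + fibS (n + 1) from rfl]
    omega

theorem fibS_strictMono : StrictMono fibS := strictMono_nat_of_lt_succ fibS_lt_fibS_succ

theorem sum_fibS_Icc_lt (m : ℕ) : ∑ i ∈ Finset.Icc 1 m, fibS i < fibS (m + 2) := by
  induction m with
  | zero => simp [fibS]
  | succ m ih =>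
    rw [Finset.sum_Icc_succ_top (by omega)]
    rw [show fibS (m + 1 + 2) = fibS (m + 2) + fibS (m + 1) from rfl]
    omega

theorem goldenCount_eq_zero_of_fibVal {m : ℕ} {v : ℤ × ℤ}
    (h : ∀ k ∈ Finset.range (fibS (m + 2)), fibVal v ≠ k) : goldenCount m v = 0 := by
  have h1 := sum_powerset_Icc_eq_tsum_goldenCount m fun w => if w = v then 1 else 0
  simp only [mul_ite, mul_one, mul_zero, tsum_ite_eq] at h1
  rw [← h1]
  refine Finset.sum_eq_zero fun S hS => if_neg ?_
  rintro rfl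
  refine h (∑ i ∈ S, fibS i) (Finset.mem_range.2 ?_) ?_
  · exact (Finset.sum_le_sum_of_subset (Finset.mem_powerset.1 hS)).trans_lt (sum_fibS_Icc_lt m)
  · exact fibVal_sum_iterate_goldenMul hS

theorem goldenMoment_eq_sum_fibCount {p : ℕ} (hp : 0 < p) (m : ℕ) :
    goldenMoment p m = ((∑ n ∈ Finset.range (fibS (m + 2)), fibCount m n ^ p : ℕ) : ℝ≥0∞) := by
  push_cast
  simp only [fibCount_pow_eq_tsum hp]
  rw [← Summable.tsum_finsetSum fun _ _ => ENNReal.summable, goldenMoment]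
  refine tsum_congr fun v => ?_
  by_cases h : ∃ k ∈ Finset.range (fibS (m + 2)), fibVal v = k
  · obtain ⟨k, hk, hv⟩ := h
    simp only [hv, Nat.cast_inj]
    rw [Finset.sum_ite_eq, if_pos hk]
  · push Not at h
    simp [goldenCount_eq_zero_of_fibVal h, hp.ne']

theorem rF_eq_fibCount {m n : ℕ} (h : n < fibS (m + 1)) : rF n = fibCount m n := by
  refine Nat.subtype_card _ fun S => ?_
  simp only [Finset.mem_filter, Finset.mem_powerset]
  refine and_congr_left fun hS => ⟨fun hsub h0 => by simpa using hsub h0, fun h0 i hi => ?_⟩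
  have h1 : fibS i ≤ n := hS ▸ Finset.single_le_sum (fun _ _ => Nat.zero_le _) hi
  have h2 := fibS_strictMono.lt_iff_lt.1 (h1.trans_lt h)
  have h3 : i ≠ 0 := fun h => h0 (h ▸ hi)
  exact Finset.mem_Icc.2 (by omega)

theorem fibCount_le_rF (m n : ℕ) : fibCount m n ≤ rF n := by
  have h : n < fibS (max m n + 1) :=
    (Nat.lt_succ_of_le (le_max_right m n)).trans_le (fibS_strictMono.id_le _)
  rw [rF_eq_fibCount h]
  exact Finset.card_le_card (Finset.filter_subset_filter _
    (Finset.powerset_mono.2 (Finset.Icc_subset_Icc_right (le_max_left m n))))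

theorem goldenMoment_toReal_le_SF {p : ℕ} (hp : 0 < p) (m : ℕ) :
    (goldenMoment p m).toReal ≤ SF p (fibS (m + 2)) := by
  rw [goldenMoment_eq_sum_fibCount hp, ENNReal.toReal_natCast, Nat.cast_le]
  exact Finset.sum_le_sum fun n _ => Nat.pow_le_pow_left (fibCount_le_rF m n) p

theorem SF_le_goldenMoment_toReal {p : ℕ} (hp : 0 < p) (m : ℕ) :
    (SF p (fibS (m + 1)) : ℝ) ≤ (goldenMoment p m).toReal := by
  rw [goldenMoment_eq_sum_fibCount hp, ENNReal.toReal_natCast, Nat.cast_le, SF]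
  rw [Finset.sum_congr rfl fun n hn => by rw [rF_eq_fibCount (Finset.mem_range.1 hn)]]
  exact Finset.sum_le_sum_of_subset
    (Finset.range_mono (fibS_strictMono.monotone (Nat.le_succ (m + 1))))

theorem SF_mono (p : ℕ) : Monotone (SF p) := fun _ _ h =>
  Finset.sum_le_sum_of_subset (Finset.range_mono h)

theorem goldenRatio_pow_le_fibS (m : ℕ) :
    Real.goldenRatio ^ m ≤ fibS (m + 1) ∧ (fibS (m + 1) : ℝ) ≤ Real.goldenRatio ^ (m + 1) := by
  have h3 := lt_goldenRatio
  have h4 := goldenRatio_lt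
  have h5 := Real.goldenRatio_sq
  induction m using Nat.twoStepInduction with
  | zero => norm_num [fibS]; linarith
  | one => norm_num [fibS]; constructor <;> nlinarith
  | more m h1 h2 =>
    rw [show fibS (m + 2 + 1) = fibS (m + 2) + fibS (m + 1) from rfl]
    push_cast
    have e := Real.goldenRatio_pow_sub_goldenRatio_pow m
    have e' := Real.goldenRatio_pow_sub_goldenRatio_pow (m + 1)
    constructor <;> linarith [h1.1, h1.2, h2.1, h2.2]

theorem exists_fibS_le_lt {N : ℕ} (hN : 2 ≤ N) : ∃ m, fibS (m + 2) ≤ N ∧ N < fibS (m + 3) := by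
  induction N, hN using Nat.le_induction with
  | base => exact ⟨0, by simp [fibS], by simp [fibS]⟩
  | succ N _ ih =>
    obtain ⟨m, h1, h2⟩ := ih
    rcases Nat.lt_or_ge (N + 1) (fibS (m + 3)) with h | h
    · exact ⟨m, by omega, h⟩
    · have := fibS_lt_fibS_succ (m + 3)
      exact ⟨m + 1, h, by rw [show m + 1 + 3 = m + 3 + 1 by ring]; omega⟩

theorem SF_asymp_algebraic (p : ℕ) (hp : 0 < p) :
    ∃ lam : ℝ, 1 < lam ∧ IsIntegral ℤ lam ∧
      ∃ c C : ℝ, 0 < c ∧ c ≤ C ∧ ∃ N₀ : ℕ, ∀ N : ℕ, N₀ ≤ N →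
        c * (N : ℝ) ^ (Real.log lam / Real.log phi) ≤ (SF p N : ℝ) ∧
        (SF p N : ℝ) ≤ C * (N : ℝ) ^ (Real.log lam / Real.log phi) := by
  have hfin := goldenMoment_ne_top hp
  obtain ⟨lam, hlam0, hK, ht⟩ := exists_geometric_bounds_of_quasi_mul
    (t := fun m => (goldenMoment p m).toReal)
    (K := (goldenBox_finite.toFinset.card : ℝ) ^ p)
    (fun m => by simpa using ENNReal.toReal_mono (hfin m) (one_le_goldenMoment p m))
    (fun m n => by
      simpa using ENNReal.toReal_mono (hfin (m + n)) (goldenMoment_mul_le hp m n))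
    (fun m n => by
      simpa using ENNReal.toReal_mono
        (ENNReal.mul_ne_top (by simp) (ENNReal.mul_ne_top (hfin m) (hfin n)))
        (goldenMoment_add_le hp m n))
  set K : ℝ := (goldenBox_finite.toFinset.card : ℝ) ^ p
  have hlam : 1 < lam := by
    have h1 := (ht 1).1
    have h2 := ENNReal.toReal_mono (hfin 1) (two_le_goldenMoment_one p)
    simp only [ENNReal.toReal_ofNat, pow_one] at h1 h2
    linarith
  have hK1 : 1 ≤ K := by
    have h1 := ht 0
    simp only [pow_zero] at h1
    nlinarith
  obtain ⟨P, hP, hrec⟩ := goldenMoment_recurrence hp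
  refine ⟨lam, hlam, isIntegral_of_recurrence_of_geometric_bounds (C := 1) hlam0 (inv_pos.2 hK)
    (fun m => (inv_mul_le_iff₀ hK).2 (ht m).2) (fun m => by simpa using (ht m).1) hP hrec,
    (K * lam ^ 3)⁻¹, lam, by positivity, ?_, 2, fun N hN => ?_⟩
  · refine le_trans (inv_le_one_of_one_le₀ ?_) hlam.le
    exact one_le_mul_of_one_le_of_one_le hK1 (one_le_pow₀ hlam.le)
  obtain ⟨m, hm1, hm2⟩ := exists_fibS_le_lt hN
  have hphi : phi = Real.goldenRatio := rfl
  rw [hphi]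
  set α := Real.log lam / Real.log Real.goldenRatio
  have hα : 0 ≤ α :=
    div_nonneg (Real.log_nonneg hlam.le) (Real.log_nonneg Real.one_lt_goldenRatio.le)
  have hpow : ∀ k : ℕ, (Real.goldenRatio ^ k) ^ α = lam ^ k := by
    intro k
    rw [← Real.rpow_pow_comm Real.goldenRatio_pos.le]
    congr 1
    exact Real.rpow_logb Real.goldenRatio_pos Real.one_lt_goldenRatio.ne' hlam0
  have hg := Real.goldenRatio_pos
  have hlow : lam ^ (m + 1) ≤ (N : ℝ) ^ α := by
    rw [← hpow]
    refine Real.rpow_le_rpow (by positivity) ?_ hα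
    exact (goldenRatio_pow_le_fibS (m + 1)).1.trans (Nat.cast_le.2 hm1)
  have hupp : (N : ℝ) ^ α ≤ lam ^ (m + 3) := by
    rw [← hpow]
    refine Real.rpow_le_rpow (by positivity) ?_ hα
    exact (Nat.cast_le.2 hm2.le).trans (goldenRatio_pow_le_fibS (m + 2)).2
  constructor
  · rw [inv_mul_le_iff₀ (by positivity)]
    calc (N : ℝ) ^ α ≤ lam ^ (m + 3) := hupp
      _ = lam ^ 3 * lam ^ m := by ring
      _ ≤ lam ^ 3 * (K * (goldenMoment p m).toReal) := by gcongr; exact (ht m).2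
      _ ≤ lam ^ 3 * (K * SF p N) := by
          gcongr
          exact (goldenMoment_toReal_le_SF hp m).trans (Nat.cast_le.2 (SF_mono p hm1))
      _ = K * lam ^ 3 * SF p N := by ring
  · calc (SF p N : ℝ) ≤ (goldenMoment p (m + 2)).toReal :=
          (Nat.cast_le.2 (SF_mono p hm2.le)).trans (SF_le_goldenMoment_toReal hp (m + 2))
      _ ≤ lam ^ (m + 2) := (ht (m + 2)).1
      _ = lam * lam ^ (m + 1) := by ring
      _ ≤ lam * (N : ℝ) ^ α := by gcongr
end

section
/- There exists a sequence of real numbers (λ_p)_{p≥1} with λ_p > 1 for every p, such that for every positive integer p one has S_F^{(p)}(N) ≍ N^{(log λ_p)/(log φ)} as N → ∞ (with implied constants depending on p), and moreover lim_{p→∞} λ_p^{1/p} = φ^{1/2}. -/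
open Finset

/-- The number of subsets of the first `k` Fibonacci numbers `1, 2, 3, 5, …` with sum `n`. -/
def rep (k n : ℕ) : ℕ :=
  #{S ∈ (range k).powerset | ∑ i ∈ S, Nat.fib (i + 2) = n}

lemma rep_succ (k n : ℕ) :
    rep (k + 1) n = rep k n + #{S ∈ (range k).powerset | ∑ i ∈ S, Nat.fib (i + 2) + Nat.fib (k + 2) = n} := by
  have hnot : ∀ S ∈ (range k).powerset, k ∉ S := fun S hS hk => by
    simpa using mem_powerset.1 hS hk
  unfold rep
  rw [range_add_one, powerset_insert, filter_union, card_union_of_disjoint]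
  · congr 1
    rw [filter_image, card_image_of_injOn]
    · congr 1
      refine filter_congr fun S hS => ?_
      rw [sum_insert (hnot S hS), add_comm]
    · intro S hS S' hS' h
      have h1 := hnot S (mem_filter.1 hS).1
      have h2 := hnot S' (mem_filter.1 hS').1
      rw [← erase_insert h1, ← erase_insert h2]
      exact congrArg (fun X => X.erase k) h
  · rw [disjoint_left]
    intro S hS hS'
    obtain ⟨S', -, rfl⟩ := mem_image.1 (mem_filter.1 hS').1
    exact hnot _ (mem_filter.1 hS).1 (mem_insert_self _ _)

lemma rep_succ_of_lt {k n : ℕ} (h : n < Nat.fib (k + 2)) : rep (k + 1) n = rep k n := by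
  rw [rep_succ, filter_false_of_mem (by intros; omega), card_empty, add_zero]

lemma rep_succ_add (k n : ℕ) :
    rep (k + 1) (n + Nat.fib (k + 2)) = rep k (n + Nat.fib (k + 2)) + rep k n := by
  rw [rep_succ]
  simp [rep]

lemma rep_le_succ (k n : ℕ) : rep k n ≤ rep (k + 1) n := by
  rw [rep_succ]; omega

lemma rep_zero_zero : rep 0 0 = 1 := rfl

lemma sum_fib_add_two_le {k : ℕ} {S : Finset ℕ} (hS : S ⊆ range k) :
    ∑ i ∈ S, Nat.fib (i + 2) + 2 ≤ Nat.fib (k + 3) := by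
  have h1 : ∑ i ∈ range k, Nat.fib (i + 2) + 2 = Nat.fib (k + 3) := by
    induction k generalizing S with
    | zero => rfl
    | succ k ih =>
      have h := Nat.fib_add_two (n := k + 2)
      have := ih (S := ∅) (by simp)
      rw [sum_range_succ]
      simp only [add_assoc, Nat.reduceAdd] at *
      omega
  have := sum_le_sum_of_subset (f := fun i => Nat.fib (i + 2)) hS
  omega

lemma rep_eq_zero {k n : ℕ} (h : Nat.fib (k + 3) ≤ n + 1) : rep k n = 0 := by
  rw [rep, card_eq_zero, filter_eq_empty_iff]
  intro S hS
  have := sum_fib_add_two_le (mem_powerset.1 hS)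
  omega

lemma rep_le_two_pow (k n : ℕ) : rep k n ≤ 2 ^ k := by
  simpa [rep] using card_filter_le (range k).powerset (fun S => ∑ i ∈ S, Nat.fib (i + 2) = n)

/-- The matrix `!![1, 1; 0, 1]` has operator norm `φ`. -/
lemma add_sq_add_sq_le (x y : ℝ) :
    (x + y) ^ 2 + y ^ 2 ≤ Real.goldenRatio ^ 2 * (x ^ 2 + y ^ 2) := by
  have h := Real.goldenRatio_sq
  have h1 := Real.one_lt_goldenRatio
  generalize Real.goldenRatio = φ at h h1 ⊢
  have : φ * (φ ^ 2 * (x ^ 2 + y ^ 2) - ((x + y) ^ 2 + y ^ 2))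
      = (φ * x - y) ^ 2 := by
    linear_combination (x ^ 2 * φ + (φ + 1) * y ^ 2) * h
  nlinarith [sq_nonneg (φ * x - y)]

lemma rep_sq_add_rep_sq_le (k m : ℕ) (hm : m < Nat.fib (k + 1)) :
    (rep k (m + Nat.fib (k + 2)) : ℝ) ^ 2 + (rep k m : ℝ) ^ 2 ≤ 32 * Real.goldenRatio ^ k := by
  have hφ := Real.goldenRatio_sq
  have hφ1 := Real.one_lt_goldenRatio
  induction k using Nat.strong_induction_on generalizing m with
  | _ k ih =>
  by_cases hk : k < 3
  · have hb : ∀ n, (rep k n : ℝ) ^ 2 ≤ 16 := fun n => by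
      have h1 : rep k n ≤ 4 :=
        (rep_le_two_pow k n).trans (Nat.pow_le_pow_right (n := 2) (by norm_num) (show k ≤ 2 by omega))
      have h2 : (rep k n : ℝ) ≤ 4 := by exact_mod_cast h1
      nlinarith [(rep k n).cast_nonneg (α := ℝ)]
    have := hb m
    have := hb (m + Nat.fib (k + 2))
    have := one_le_pow₀ (n := k) hφ1.le
    linarith
  obtain ⟨k, rfl⟩ : ∃ j, k = j + 3 := ⟨k - 3, by omega⟩
  have e2 := Nat.fib_add_two (n := k)
  have e3 := Nat.fib_add_two (n := k + 1)
  have e4 := Nat.fib_add_two (n := k + 2)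
  have e5 := Nat.fib_add_two (n := k + 3)
  simp only [add_assoc, Nat.reduceAdd] at *
  have hx : rep (k + 3) (m + Nat.fib (k + 5)) = rep (k + 1) (m + Nat.fib (k + 3)) + rep (k + 1) m := by
    have h1 := rep_succ_add (k + 2) (m + Nat.fib (k + 3))
    have h2 := rep_succ_add (k + 1) m
    simp only [add_assoc, Nat.reduceAdd] at h1 h2
    rw [show m + Nat.fib (k + 5) = m + (Nat.fib (k + 3) + Nat.fib (k + 4)) by omega, h1, h2,
      rep_eq_zero (k := k + 2) (by simp only [add_assoc, Nat.reduceAdd]; omega), zero_add]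
  have hy : rep (k + 3) m = rep (k + 2) m := rep_succ_of_lt (by simpa [add_assoc] using hm)
  rw [hx, hy]
  by_cases h1 : Nat.fib (k + 3) ≤ m
  · obtain ⟨l, rfl⟩ := Nat.exists_eq_add_of_le' h1
    have h2 := rep_succ_add (k + 1) l
    simp only [add_assoc, Nat.reduceAdd] at h2
    rw [h2, rep_eq_zero (k := k + 1) (by simp only [add_assoc, Nat.reduceAdd]; omega), zero_add]
    have h3 := ih (k + 1) (by omega) l (by simp only [add_assoc, Nat.reduceAdd]; omega)
    simp only [add_assoc, Nat.reduceAdd] at h3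
    have h4 := add_sq_add_sq_le (rep (k + 1) l) (rep (k + 1) (l + Nat.fib (k + 3)))
    push_cast
    calc _ = ((rep (k + 1) l : ℝ) + (rep (k + 1) (l + Nat.fib (k + 3)))) ^ 2 +
          (rep (k + 1) (l + Nat.fib (k + 3)) : ℝ) ^ 2 := by ring
      _ ≤ _ := h4
      _ ≤ Real.goldenRatio ^ 2 * (32 * Real.goldenRatio ^ (k + 1)) := by
        gcongr; linarith
      _ = _ := by ring
  have hy' : rep (k + 2) m = rep (k + 1) m := rep_succ_of_lt (by simp only [add_assoc, Nat.reduceAdd]; omega)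
  rw [hy']
  by_cases h2 : Nat.fib (k + 2) ≤ m
  · rw [rep_eq_zero (k := k + 1) (n := m + _) (by simp only [add_assoc, Nat.reduceAdd]; omega), zero_add]
    obtain ⟨l, rfl⟩ := Nat.exists_eq_add_of_le' h2
    rw [rep_succ_add]
    have h3 := ih k (by omega) l (by omega)
    push_cast
    have h4 : (4 : ℝ) ≤ Real.goldenRatio ^ 3 := by
      have : 3 / 2 ≤ Real.goldenRatio := by nlinarith
      nlinarith
    have h5 : (4 : ℝ) * (32 * Real.goldenRatio ^ k) ≤
        Real.goldenRatio ^ 3 * (32 * Real.goldenRatio ^ k) := by gcongr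
    rw [pow_add]
    nlinarith [sq_nonneg ((rep k (l + Nat.fib (k + 2)) : ℝ) - rep k l)]
  · have h3 := ih (k + 1) (by omega) m (by simp only [add_assoc, Nat.reduceAdd]; omega)
    simp only [add_assoc, Nat.reduceAdd] at h3
    have h4 := add_sq_add_sq_le (rep (k + 1) (m + Nat.fib (k + 3))) (rep (k + 1) m)
    push_cast
    refine h4.trans ?_
    calc _ ≤ Real.goldenRatio ^ 2 * (32 * Real.goldenRatio ^ (k + 1)) := by gcongr
      _ = _ := by ring

lemma rep_sq_le (k n : ℕ) : (rep k n : ℝ) ^ 2 ≤ 64 * Real.goldenRatio ^ k := by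
  have hφ1 := Real.one_lt_goldenRatio
  induction k with
  | zero =>
    have h : (rep 0 n : ℝ) ≤ 1 := by exact_mod_cast rep_le_two_pow 0 n
    nlinarith [(rep 0 n).cast_nonneg (α := ℝ)]
  | succ k ih =>
    have hmono : Real.goldenRatio ^ k ≤ Real.goldenRatio ^ (k + 1) :=
      pow_le_pow_right₀ hφ1.le (by omega)
    have e3 := Nat.fib_add_two (n := k + 1)
    have e4 := Nat.fib_add_two (n := k + 2)
    simp only [add_assoc, Nat.reduceAdd] at *
    by_cases h1 : n < Nat.fib (k + 2)
    · rw [rep_succ_of_lt h1]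
      linarith
    by_cases h2 : n < Nat.fib (k + 3)
    · obtain ⟨l, rfl⟩ := Nat.exists_eq_add_of_le' (not_lt.1 h1)
      have h3 := rep_sq_add_rep_sq_le k l (by omega)
      rw [rep_succ_add]
      push_cast
      nlinarith [sq_nonneg ((rep k (l + Nat.fib (k + 2)) : ℝ) - rep k l)]
    by_cases h3 : n < Nat.fib (k + 4)
    · obtain ⟨l, rfl⟩ := Nat.exists_eq_add_of_le' (not_lt.1 h2)
      have h4 := rep_sq_add_rep_sq_le (k + 1) l (by simp only [add_assoc, Nat.reduceAdd]; omega)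
      simp only [add_assoc, Nat.reduceAdd] at h4
      nlinarith [pow_pos Real.goldenRatio_pos (k + 1)]
    · rw [rep_eq_zero (by simp only [add_assoc, Nat.reduceAdd]; omega)]
      simp
      positivity

lemma exists_fib_le_rep (j : ℕ) : ∃ m, Nat.fib (2 * j) ≤ rep (4 * j) (m + Nat.fib (4 * j + 2)) ∧
    Nat.fib (2 * j + 1) ≤ rep (4 * j) m := by
  induction j with
  | zero => exact ⟨0, by simp, by simp [rep_zero_zero]⟩
  | succ j ih =>
    have hx : ∀ k m, rep k (m + Nat.fib (k + 2)) + rep k m ≤ rep (k + 2) (m + Nat.fib (k + 4)) := by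
      intro k m
      have h1 := rep_succ_add (k + 1) (m + Nat.fib (k + 2))
      have h2 := rep_succ_add k m
      have e4 := Nat.fib_add_two (n := k + 2)
      simp only [add_assoc, Nat.reduceAdd] at *
      rw [e4, h1, h2]
      omega
    have hle : ∀ k m, rep k m ≤ rep (k + 2) m := fun k m =>
      (rep_le_succ _ _).trans (rep_le_succ _ _)
    obtain ⟨m, h1, h2⟩ := ih
    set k := 4 * j with hk
    have a1 := hx k m
    have a2 := hle k m
    refine ⟨m + Nat.fib (k + 4), ?_, ?_⟩
    · have := hx (k + 2) (m + Nat.fib (k + 4))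
      rw [show 4 * (j + 1) = k + 4 by omega, show 2 * (j + 1) = 2 * j + 2 by omega,
        Nat.fib_add_two]
      simp only [add_assoc, Nat.reduceAdd] at *
      omega
    · have b := rep_succ_add (k + 2) m
      have b' := rep_le_succ (k + 3) (m + Nat.fib (k + 4))
      rw [show 4 * (j + 1) = k + 4 by omega, show 2 * (j + 1) + 1 = 2 * j + 1 + 2 by omega,
        Nat.fib_add_two, Nat.fib_add_two]
      simp only [add_assoc, Nat.reduceAdd] at *
      omega

/-- The `p`-th power sum of the sizes of the nonempty fibres of `g` on `A`. -/
def fiberPowSum {α β : Type*} [DecidableEq β] (p : ℕ) (A : Finset α) (g : α → β) : ℕ :=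
  ∑ y ∈ A.image g, #{a ∈ A | g a = y} ^ p

section fiberPowSum

variable {α β γ δ : Type*} [DecidableEq β] [DecidableEq γ]

lemma fiberPowSum_eq_sum {p : ℕ} (hp : p ≠ 0) {A : Finset α} {g : α → β} {Y : Finset β}
    (h : A.image g ⊆ Y) : fiberPowSum p A g = ∑ y ∈ Y, #{a ∈ A | g a = y} ^ p := by
  refine sum_subset h fun y _ hy => ?_
  rw [filter_false_of_mem, card_empty, zero_pow hp]
  rintro a ha rfl
  exact hy (mem_image_of_mem g ha)

lemma card_fiber_comp (A : Finset α) (g : α → β) (h : β → γ) (c : γ) :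
    #{a ∈ A | h (g a) = c} = ∑ y ∈ A.image g with h y = c, #{a ∈ A | g a = y} := by
  rw [card_eq_sum_card_fiberwise (f := g) (t := {y ∈ A.image g | h y = c})]
  · refine sum_congr rfl fun y hy => ?_
    rw [filter_filter]
    congr 1
    refine filter_congr fun a _ => ?_
    have := (mem_filter.1 hy).2
    constructor
    · exact fun h => h.2
    · rintro rfl
      exact ⟨this, rfl⟩
  · intro a ha
    have := mem_filter.1 (mem_coe.1 ha)
    exact mem_coe.2 (mem_filter.2 ⟨mem_image_of_mem g this.1, this.2⟩)

lemma fiberPowSum_eq_sum_sum (p : ℕ) (A : Finset α) (g : α → β) (h : β → γ) :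
    fiberPowSum p A g =
      ∑ c ∈ A.image (h ∘ g), ∑ y ∈ A.image g with h y = c, #{a ∈ A | g a = y} ^ p := by
  rw [fiberPowSum, sum_fiberwise_of_maps_to]
  intro y hy
  obtain ⟨a, ha, rfl⟩ := mem_image.1 hy
  exact mem_image_of_mem (h ∘ g) ha

lemma sum_pow_le_pow_sum_nat {p : ℕ} (hp : p ≠ 0) (s : Finset β) (f : β → ℕ) :
    ∑ i ∈ s, f i ^ p ≤ (∑ i ∈ s, f i) ^ p := by
  induction s using Finset.induction_on with
  | empty => simp
  | insert a s ha ih =>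
    rw [sum_insert ha, sum_insert ha]
    exact (Nat.add_le_add_left ih _).trans (pow_add_pow_le (Nat.zero_le _) (Nat.zero_le _) hp)

lemma fiberPowSum_le_comp {p : ℕ} (hp : p ≠ 0) (A : Finset α) (g : α → β) (h : β → γ) :
    fiberPowSum p A g ≤ fiberPowSum p A (h ∘ g) := by
  rw [fiberPowSum_eq_sum_sum p A g h, fiberPowSum]
  refine sum_le_sum fun c _ => ?_
  simp only [Function.comp]
  rw [card_fiber_comp]
  exact sum_pow_le_pow_sum_nat hp _ _

lemma fiberPowSum_comp_le {p C : ℕ} (A : Finset α) (g : α → β) (h : β → γ)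
    (hC : ∀ c, #{y ∈ A.image g | h y = c} ≤ C) :
    fiberPowSum p A (h ∘ g) ≤ C ^ p * fiberPowSum p A g := by
  rw [fiberPowSum_eq_sum_sum p A g h, fiberPowSum, mul_sum]
  refine sum_le_sum fun c hc => ?_
  simp only [Function.comp]
  rw [card_fiber_comp]
  set s := {y ∈ A.image g | h y = c} with hs
  set f : β → ℕ := fun y => #{a ∈ A | g a = y}
  have hne : s.Nonempty := by
    obtain ⟨a, ha, rfl⟩ := mem_image.1 hc
    exact ⟨g a, mem_filter.2 ⟨mem_image_of_mem g ha, rfl⟩⟩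
  obtain ⟨y, hy, hmax⟩ := exists_max_image s f hne
  calc (∑ i ∈ s, f i) ^ p ≤ (C * f y) ^ p := by
        gcongr
        calc _ ≤ #s • f y := sum_le_card_nsmul _ _ _ hmax
          _ ≤ C * f y := by rw [smul_eq_mul]; gcongr; exact hC c
    _ = C ^ p * f y ^ p := mul_pow _ _ _
    _ ≤ _ := by
      gcongr
      exact single_le_sum (f := fun y => f y ^ p) (fun _ _ => Nat.zero_le _) hy

lemma fiberPowSum_prod (p : ℕ) (A : Finset α) (B : Finset δ) (g : α → β) (h : δ → γ) :
    fiberPowSum p (A ×ˢ B) (Prod.map g h) = fiberPowSum p A g * fiberPowSum p B h := by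
  rw [fiberPowSum, fiberPowSum, fiberPowSum, sum_mul_sum, ← sum_product', prodMap_image_product]
  refine sum_congr rfl fun y _ => ?_
  rw [← mul_pow, ← card_product, ← filter_product]
  congr 2
  refine filter_congr fun a _ => ?_
  simp [Prod.ext_iff]

lemma fiberPowSum_image [DecidableEq α] {p : ℕ} {B : Finset δ} {e : δ → α}
    (he : Set.InjOn e B) (g : α → β) :
    fiberPowSum p (B.image e) g = fiberPowSum p B (g ∘ e) := by
  rw [fiberPowSum, fiberPowSum, image_image]
  refine sum_congr rfl fun y _ => ?_
  rw [filter_image, card_image_of_injOn]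
  · rfl
  · exact he.mono fun a ha => (mem_filter.1 (mem_coe.1 ha)).1

end fiberPowSum

/-- The pair of consecutive Fibonacci sums attached to `S`. -/
def fibPair (S : Finset ℕ) : ℕ × ℕ :=
  (∑ i ∈ S, Nat.fib (i + 2), ∑ i ∈ S, Nat.fib (i + 1))

lemma abs_fibPair_le (S : Finset ℕ) :
    |((fibPair S).1 : ℝ) - Real.goldenRatio * (fibPair S).2| ≤ Real.goldenRatio := by
  obtain ⟨m, hm⟩ : ∃ m, S ⊆ range m := S.exists_nat_subset_range
  have hφ1 := Real.one_lt_goldenRatio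
  have h1 : ((fibPair S).1 : ℝ) - Real.goldenRatio * (fibPair S).2 =
      ∑ i ∈ S, Real.goldenConj ^ (i + 1) := by
    simp only [fibPair]
    push_cast
    rw [mul_sum, ← sum_sub_distrib]
    exact sum_congr rfl fun i _ => Real.fib_succ_sub_goldenRatio_mul_fib (i + 1)
  have h2 : |Real.goldenConj| = Real.goldenRatio - 1 := by
    rw [abs_of_neg Real.goldenConj_neg]
    linarith [Real.goldenRatio_add_goldenConj]
  have h3 : ∑ i ∈ range m, (Real.goldenRatio - 1) ^ (i + 1) =
      Real.goldenRatio * (1 - (Real.goldenRatio - 1) ^ m) := by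
    clear hm
    induction m with
    | zero => simp
    | succ m ih =>
      rw [sum_range_succ, ih]
      linear_combination (Real.goldenRatio - 1) ^ m * Real.goldenRatio_sq
  calc _ ≤ ∑ i ∈ S, |Real.goldenConj ^ (i + 1)| := by rw [h1]; exact abs_sum_le_sum_abs _ _
    _ = ∑ i ∈ S, (Real.goldenRatio - 1) ^ (i + 1) := by simp only [abs_pow, h2]
    _ ≤ ∑ i ∈ range m, (Real.goldenRatio - 1) ^ (i + 1) :=
      sum_le_sum_of_subset_of_nonneg hm fun i _ _ => pow_nonneg (by linarith) _
    _ ≤ _ := by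
      rw [h3]
      have : 0 ≤ (Real.goldenRatio - 1) ^ m := pow_nonneg (by linarith) _
      nlinarith

lemma fibPair_snd_close {S T : Finset ℕ} (h : (fibPair S).1 ≤ (fibPair T).1 + 3) : (fibPair S).2 ≤ (fibPair T).2 + 3 := by
  have hS := abs_le.1 (abs_fibPair_le S)
  have hT := abs_le.1 (abs_fibPair_le T)
  have hφ := Real.goldenRatio_sq
  have hφ1 := Real.one_lt_goldenRatio
  have hφ2 : 3 / 2 < Real.goldenRatio := by nlinarith
  by_contra! hlt
  have h3 : ((fibPair S).1 : ℝ) ≤ (fibPair T).1 + 3 := by exact_mod_cast h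
  have h4 : ((fibPair T).2 : ℝ) + 4 ≤ (fibPair S).2 := by exact_mod_cast hlt
  nlinarith

lemma fibPair_snd_le {S T : Finset ℕ} (h : (fibPair S).1 + 4 ≤ (fibPair T).1) :
    (fibPair S).2 ≤ (fibPair T).2 := by
  have hS := abs_le.1 (abs_fibPair_le S)
  have hT := abs_le.1 (abs_fibPair_le T)
  have hφ2 := Real.goldenRatio_lt_two
  have hφ1 := Real.one_lt_goldenRatio
  by_contra! hlt
  have h3 : ((fibPair S).1 : ℝ) + 4 ≤ (fibPair T).1 := by exact_mod_cast h
  have h4 : ((fibPair T).2 : ℝ) + 1 ≤ (fibPair S).2 := by exact_mod_cast hlt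
  nlinarith

lemma card_le_of_forall_close {X : Finset (ℕ × ℕ)}
    (h : ∀ x ∈ X, ∀ y ∈ X, x.1 ≤ y.1 + 3 ∧ x.2 ≤ y.2 + 3) : #X ≤ 49 := by
  obtain rfl | ⟨x, hx⟩ := X.eq_empty_or_nonempty
  · simp
  refine (card_le_card (t := Icc (x.1 - 3) (x.1 + 3) ×ˢ Icc (x.2 - 3) (x.2 + 3)) ?_).trans ?_
  · intro y hy
    have h1 := h x hx y hy
    have h2 := h y hy x hx
    simp only [mem_product, mem_Icc]
    omega
  · rw [card_product, Nat.card_Icc, Nat.card_Icc]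
    calc _ ≤ 7 * 7 := Nat.mul_le_mul (by omega) (by omega)
      _ = 49 := rfl

/-- The `p`-th power sum of the values of `rep k`. -/
def repPowSum (p k : ℕ) : ℕ :=
  fiberPowSum p (range k).powerset (fun S => ∑ i ∈ S, Nat.fib (i + 2))

lemma repPowSum_eq_sum {p : ℕ} (hp : p ≠ 0) (k : ℕ) :
    repPowSum p k = ∑ n ∈ range (Nat.fib (k + 3)), rep k n ^ p := by
  refine fiberPowSum_eq_sum hp ?_
  intro n hn
  obtain ⟨S, hS, rfl⟩ := mem_image.1 hn
  have := sum_fib_add_two_le (mem_powerset.1 hS)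
  simp only [mem_range]
  omega

lemma rep_pow_le_repPowSum {p : ℕ} (hp : p ≠ 0) (k n : ℕ) : rep k n ^ p ≤ repPowSum p k := by
  rw [repPowSum_eq_sum hp]
  by_cases h : n < Nat.fib (k + 3)
  · exact single_le_sum (f := fun n => rep k n ^ p) (fun _ _ => Nat.zero_le _) (mem_range.2 h)
  · rw [rep_eq_zero (by omega), zero_pow hp]
    exact Nat.zero_le _

lemma two_pow_le_repPowSum {p : ℕ} (hp : p ≠ 0) (k : ℕ) : 2 ^ k ≤ repPowSum p k := by
  rw [repPowSum, fiberPowSum]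
  have h := card_eq_sum_card_image (fun S => ∑ i ∈ S, Nat.fib (i + 2)) (range k).powerset
  rw [card_powerset, card_range] at h
  rw [h]
  exact sum_le_sum fun n _ => Nat.le_self_pow hp _

/-- Passing from the sums to the pairs of sums changes the power sum by a bounded factor. -/
lemma repPowSum_fibPair {p : ℕ} (hp : p ≠ 0) (m : ℕ) :
    fiberPowSum p (range m).powerset fibPair ≤ repPowSum p m ∧
      repPowSum p m ≤ 49 ^ p * fiberPowSum p (range m).powerset fibPair := by
  refine ⟨fiberPowSum_le_comp hp _ fibPair Prod.fst,
    fiberPowSum_comp_le _ fibPair Prod.fst fun c => card_le_of_forall_close ?_⟩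
  intro x hx y hy
  obtain ⟨hx, hxc⟩ := mem_filter.1 hx
  obtain ⟨hy, hyc⟩ := mem_filter.1 hy
  obtain ⟨S, -, rfl⟩ := mem_image.1 hx
  obtain ⟨T, -, rfl⟩ := mem_image.1 hy
  exact ⟨by omega, fibPair_snd_close (by omega)⟩

lemma powerset_range_add (k m : ℕ) : (range (k + m)).powerset =
    ((range k).powerset ×ˢ (range m).powerset).image
      (fun x => x.1 ∪ x.2.map (addLeftEmbedding k)) := by
  ext S
  simp only [mem_powerset, mem_image, mem_product, Prod.exists]
  constructor
  · intro hS
    refine ⟨{i ∈ S | i < k}, {i ∈ range m | k + i ∈ S}, ⟨?_, filter_subset _ _⟩, ?_⟩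
    · intro i hi
      exact mem_range.2 (mem_filter.1 hi).2
    · ext i
      simp only [mem_union, mem_filter, mem_map, mem_range, addLeftEmbedding_apply]
      constructor
      · rintro (h | ⟨j, h, rfl⟩)
        · exact h.1
        · exact h.2
      · intro hi
        by_cases hik : i < k
        · exact Or.inl ⟨hi, hik⟩
        · have := mem_range.1 (hS hi)
          have h3 : k + (i - k) = i := by omega
          exact Or.inr ⟨i - k, ⟨by omega, by rwa [h3]⟩, h3⟩
  · rintro ⟨U, V, ⟨hU, hV⟩, rfl⟩ i hi
    simp only [mem_union, mem_map, addLeftEmbedding_apply] at hi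
    rw [mem_range]
    obtain hi | ⟨j, hj, rfl⟩ := hi
    · have := mem_range.1 (hU hi)
      omega
    · have := mem_range.1 (hV hj)
      omega

lemma mem_union_map_lt {k i : ℕ} {U V : Finset ℕ} (hi : i < k) :
    i ∈ U ∪ V.map (addLeftEmbedding k) ↔ i ∈ U := by
  simp only [mem_union, mem_map, addLeftEmbedding_apply, or_iff_left_iff_imp]
  rintro ⟨j, -, rfl⟩
  omega

lemma mem_union_map_add {k i : ℕ} {U V : Finset ℕ} (hU : U ⊆ range k) :
    k + i ∈ U ∪ V.map (addLeftEmbedding k) ↔ i ∈ V := by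
  simp only [mem_union, mem_map, addLeftEmbedding_apply, add_right_inj, exists_eq_right,
    or_iff_right_iff_imp]
  intro h
  have := mem_range.1 (hU h)
  omega

lemma injOn_union_map (k m : ℕ) : Set.InjOn
    (fun x : Finset ℕ × Finset ℕ => x.1 ∪ x.2.map (addLeftEmbedding k))
    ((range k).powerset ×ˢ (range m).powerset : Finset _) := by
  rintro ⟨U, V⟩ hx ⟨U', V'⟩ hy h
  simp only [coe_product, Set.mem_prod, mem_coe, mem_powerset] at hx hy h
  refine Prod.ext (Finset.ext fun i => ?_) (Finset.ext fun i => ?_)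
  · change i ∈ U ↔ i ∈ U'
    by_cases hik : i < k
    · rw [← mem_union_map_lt (V := V) hik, h, mem_union_map_lt hik]
    · exact iff_of_false (fun hi => hik (mem_range.1 (hx.1 hi)))
        (fun hi => hik (mem_range.1 (hy.1 hi)))
  · change i ∈ V ↔ i ∈ V'
    rw [← mem_union_map_add hx.1, h, mem_union_map_add hy.1]

lemma sum_fib_union_map {k : ℕ} {U V : Finset ℕ} (hU : U ⊆ range k) :
    ∑ i ∈ U ∪ V.map (addLeftEmbedding k), Nat.fib (i + 2) =
      ∑ i ∈ U, Nat.fib (i + 2) +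
        (Nat.fib (k + 1) * (fibPair V).1 + Nat.fib k * (fibPair V).2) := by
  rw [sum_union, sum_map]
  · congr 1
    simp only [fibPair, mul_sum, ← sum_add_distrib, addLeftEmbedding_apply]
    refine sum_congr rfl fun i _ => ?_
    rw [show k + i + 2 = k + (i + 1) + 1 by ring, Nat.fib_add]
    ring
  · rw [disjoint_left]
    intro i hi hi'
    obtain ⟨j, -, rfl⟩ := mem_map.1 hi'
    have := mem_range.1 (hU hi)
    simp at this

/-- The pair sums are determined up to bounded error by the sum of a concatenation. -/
lemma fibPair_fst_close {k u v : ℕ} {S T : Finset ℕ} (hv : v + 2 ≤ Nat.fib (k + 3))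
    (h : u + (Nat.fib (k + 1) * (fibPair S).1 + Nat.fib k * (fibPair S).2) =
      v + (Nat.fib (k + 1) * (fibPair T).1 + Nat.fib k * (fibPair T).2)) :
    (fibPair S).1 ≤ (fibPair T).1 + 3 := by
  by_contra! hlt
  have h1 := fibPair_snd_le (S := T) (T := S) (by omega)
  have h2 := Nat.mul_le_mul_left (Nat.fib k) h1
  have h3 : Nat.fib (k + 1) * ((fibPair T).1 + 4) ≤ Nat.fib (k + 1) * (fibPair S).1 :=
    Nat.mul_le_mul_left _ hlt
  have e2 := Nat.fib_add_two (n := k)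
  have e3 := Nat.fib_add_two (n := k + 1)
  have e0 := Nat.fib_le_fib_succ (n := k)
  simp only [add_assoc, Nat.reduceAdd] at *
  rw [mul_add] at h3
  omega

lemma repPowSum_add_eq (p k m : ℕ) : repPowSum p (k + m) =
    fiberPowSum p ((range k).powerset ×ˢ (range m).powerset)
      ((fun y : ℕ × ℕ × ℕ => y.1 + (Nat.fib (k + 1) * y.2.1 + Nat.fib k * y.2.2)) ∘
        Prod.map (fun S => ∑ i ∈ S, Nat.fib (i + 2)) fibPair) := by
  rw [repPowSum, powerset_range_add, fiberPowSum_image (injOn_union_map k m)]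
  have : ∀ x ∈ (range k).powerset ×ˢ (range m).powerset,
      ((fun S => ∑ i ∈ S, Nat.fib (i + 2)) ∘
        fun x : Finset ℕ × Finset ℕ => x.1 ∪ x.2.map (addLeftEmbedding k)) x =
      ((fun y : ℕ × ℕ × ℕ => y.1 + (Nat.fib (k + 1) * y.2.1 + Nat.fib k * y.2.2)) ∘
        Prod.map (fun S => ∑ i ∈ S, Nat.fib (i + 2)) fibPair) x := by
    intro x hx
    exact sum_fib_union_map (mem_powerset.1 (mem_product.1 hx).1)
  rw [fiberPowSum, fiberPowSum, image_congr this]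
  refine sum_congr rfl fun n _ => ?_
  congr 2
  exact filter_congr fun x hx => by rw [this x hx]

lemma repPowSum_add {p : ℕ} (hp : p ≠ 0) (k m : ℕ) :
    repPowSum p k * repPowSum p m ≤ 49 ^ p * repPowSum p (k + m) ∧
      repPowSum p (k + m) ≤ 49 ^ p * (repPowSum p k * repPowSum p m) := by
  obtain ⟨h1, h2⟩ := repPowSum_fibPair hp m
  set A := (range k).powerset ×ˢ (range m).powerset
  set g : Finset ℕ × Finset ℕ → ℕ × ℕ × ℕ :=
    Prod.map (fun S => ∑ i ∈ S, Nat.fib (i + 2)) fibPair with hg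
  have hprod : fiberPowSum p A g =
      repPowSum p k * fiberPowSum p (range m).powerset fibPair := fiberPowSum_prod _ _ _ _ _
  constructor
  · calc _ ≤ repPowSum p k * (49 ^ p * fiberPowSum p (range m).powerset fibPair) := by gcongr
      _ = 49 ^ p * fiberPowSum p A g := by rw [hprod]; ring
      _ ≤ _ := by
        rw [repPowSum_add_eq]
        gcongr
        exact fiberPowSum_le_comp hp _ _ _
  · calc _ ≤ 49 ^ p * fiberPowSum p A g := by
          rw [repPowSum_add_eq]
          refine fiberPowSum_comp_le _ _ _ fun c => ?_
          set X := {y ∈ A.image g | y.1 + (Nat.fib (k + 1) * y.2.1 + Nat.fib k * y.2.2) = c}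
          have hX : ∀ y ∈ X, ∃ S, fibPair S = y.2 ∧ y.1 + 2 ≤ Nat.fib (k + 3) ∧
              y.1 + (Nat.fib (k + 1) * y.2.1 + Nat.fib k * y.2.2) = c := by
            intro y hy
            obtain ⟨hy, hyc⟩ := mem_filter.1 hy
            obtain ⟨⟨U, V⟩, hUV, rfl⟩ := mem_image.1 hy
            exact ⟨V, rfl, sum_fib_add_two_le (mem_powerset.1 (mem_product.1 hUV).1), hyc⟩
          have hinj : Set.InjOn Prod.snd (X : Set (ℕ × ℕ × ℕ)) := by
            intro x hx y hy hxy
            obtain ⟨-, -, -, hx⟩ := hX x hx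
            obtain ⟨-, -, -, hy⟩ := hX y hy
            rw [hxy] at hx
            exact Prod.ext (by omega) hxy
          rw [← card_image_of_injOn hinj]
          refine card_le_of_forall_close fun x hx y hy => ?_
          obtain ⟨x', hx', rfl⟩ := mem_image.1 hx
          obtain ⟨y', hy', rfl⟩ := mem_image.1 hy
          obtain ⟨S, hS, -, hx2⟩ := hX x' hx'
          obtain ⟨T, hT, hy1, hy2⟩ := hX y' hy'
          rw [← hS] at hx2 ⊢
          rw [← hT] at hy2 ⊢
          have h3 := fibPair_fst_close hy1 (hx2.trans hy2.symm)
          exact ⟨h3, fibPair_snd_close h3⟩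
      _ ≤ _ := by rw [hprod]; gcongr

lemma fibS_add_one (i : ℕ) : fibS (i + 1) = Nat.fib (i + 2) := by
  induction i using Nat.twoStepInduction with
  | zero => rfl
  | one => rfl
  | more i ih1 ih2 =>
    rw [fibS, ih1, ih2, Nat.fib_add_two (n := i + 2), add_comm]

lemma rF_eq_card (n : ℕ) :
    rF n = Nat.card {S : Finset ℕ // ∑ i ∈ S, Nat.fib (i + 2) = n} := by
  refine Nat.card_congr ⟨
    fun S => ⟨(S.1.erase 0).image Nat.pred, ?_⟩,
    fun S => ⟨S.1.map (addRightEmbedding 1), ?_, ?_⟩, ?_, ?_⟩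
  · obtain ⟨S, h0, hS⟩ := S
    have hpos : ∀ i ∈ S, i.pred + 1 = i := fun i hi => by
      have : i ≠ 0 := fun h => h0 (h ▸ hi)
      exact Nat.succ_pred_eq_of_ne_zero this
    rw [erase_eq_of_notMem h0, sum_image]
    · rw [← hS]
      refine sum_congr rfl fun i hi => ?_
      rw [← fibS_add_one, hpos i hi]
    · intro i hi j hj h
      rw [← hpos i hi, ← hpos j hj, h]
  · simp
  · rw [sum_map]
    simpa [fibS_add_one] using S.2
  · rintro ⟨S, h0, hS⟩
    refine Subtype.ext (Finset.ext fun i => ?_)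
    have hpos : ∀ i ∈ S, i ≠ 0 := fun i hi h => h0 (h ▸ hi)
    simp only [erase_eq_of_notMem h0, mem_map, mem_image, addRightEmbedding_apply]
    constructor
    · rintro ⟨_, ⟨j, hj, rfl⟩, rfl⟩
      rwa [← Nat.succ_eq_add_one, Nat.succ_pred_eq_of_ne_zero (hpos j hj)]
    · intro hi
      exact ⟨_, ⟨i, hi, rfl⟩, Nat.succ_pred_eq_of_ne_zero (hpos i hi)⟩
  · rintro ⟨S, hS⟩
    refine Subtype.ext (Finset.ext fun i => ?_)
    simp

lemma rF_eq_rep {k n : ℕ} (h : n < Nat.fib (k + 2)) : rF n = rep k n := by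
  rw [rF_eq_card, rep]
  refine Nat.subtype_card _ fun S => ?_
  simp only [mem_filter, mem_powerset, and_iff_right_iff_imp]
  rintro rfl i hi
  by_contra hik
  have h1 := single_le_sum (f := fun i => Nat.fib (i + 2)) (fun _ _ => Nat.zero_le _) hi
  have h2 : Nat.fib (k + 2) ≤ Nat.fib (i + 2) :=
    Nat.fib_mono (by have := mt mem_range.2 hik; omega)
  omega

lemma rep_le_rF (k n : ℕ) : rep k n ≤ rF n := by
  have hmono : Monotone fun k => rep k n := monotone_nat_of_le_succ fun k => rep_le_succ k n
  have h : n < Nat.fib (k + n + 2 + 2) := by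
    have := Nat.le_fib_add_one (k + n + 2 + 2)
    omega
  rw [rF_eq_rep h]
  exact hmono (by omega)

lemma repPowSum_le_SF {p : ℕ} (hp : p ≠ 0) {k N : ℕ} (h : Nat.fib (k + 3) ≤ N) :
    repPowSum p k ≤ SF p N := by
  rw [repPowSum_eq_sum hp, SF]
  calc _ ≤ ∑ n ∈ range (Nat.fib (k + 3)), rF n ^ p := by gcongr; exact rep_le_rF _ _
    _ ≤ _ := sum_le_sum_of_subset (range_mono h)

lemma SF_le_repPowSum {p : ℕ} (hp : p ≠ 0) {k N : ℕ} (h : N ≤ Nat.fib (k + 2)) :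
    SF p N ≤ repPowSum p k := by
  rw [repPowSum_eq_sum hp, SF]
  calc _ = ∑ n ∈ range N, rep k n ^ p :=
        sum_congr rfl fun n hn => by rw [rF_eq_rep ((mem_range.1 hn).trans_le h)]
    _ ≤ _ := sum_le_sum_of_subset (range_mono (h.trans Nat.fib_le_fib_succ))

/-- A sequence that is multiplicative up to bounded factors grows like a geometric sequence. -/
lemma exists_geometric_growth {a : ℕ → ℝ} {C : ℝ} (hC : 1 ≤ C) (ha : ∀ k, 1 ≤ a k)
    (hl : ∀ k m, a k * a m ≤ C * a (k + m)) (hu : ∀ k m, a (k + m) ≤ C * (a k * a m)) :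
    ∃ L : ℝ, 0 < L ∧ ∀ k, L ^ k ≤ C * a k ∧ a k ≤ C * L ^ k := by
  have hC0 : 0 < C := by linarith
  have ha0 : ∀ k, 0 < a k := fun k => by linarith [ha k]
  set u : ℕ → ℝ := fun k => Real.log (C * a k) with hu_def
  have hsub : Subadditive u := fun k m => by
    rw [hu_def]
    simp only
    rw [← Real.log_mul (mul_pos hC0 (ha0 k)).ne' (mul_pos hC0 (ha0 m)).ne']
    refine Real.log_le_log (mul_pos hC0 (ha0 _)) ?_
    calc _ ≤ C * (C * (a k * a m)) := by gcongr; exact hu k m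
      _ = _ := by ring
  have hbdd : BddBelow (Set.range fun n => u n / n) := by
    refine ⟨0, ?_⟩
    rintro _ ⟨n, rfl⟩
    exact div_nonneg (Real.log_nonneg (one_le_mul_of_one_le_of_one_le hC (ha n))) n.cast_nonneg
  refine ⟨Real.exp hsub.lim, Real.exp_pos _, fun k => ⟨?_, ?_⟩⟩
  · rw [← Real.exp_nat_mul, ← Real.le_log_iff_exp_le (mul_pos hC0 (ha0 k))]
    obtain rfl | hk := eq_or_ne k 0
    · simpa using Real.log_nonneg (one_le_mul_of_one_le_of_one_le hC (ha 0))
    · have := hsub.lim_le_div hbdd hk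
      rwa [le_div_iff₀ (by positivity), mul_comm] at this
  · have hpow : ∀ j, (a k / C) ^ j ≤ C * a (j * k) := fun j => by
      induction j with
      | zero => simpa using one_le_mul_of_one_le_of_one_le hC (ha 0)
      | succ j ih =>
        calc _ = (a k / C) ^ j * (a k / C) := pow_succ _ _
          _ ≤ C * a (j * k) * (a k / C) := by
            gcongr
            exact (div_pos (ha0 k) hC0).le
          _ = a (j * k) * a k := by field_simp
          _ ≤ _ := by rw [add_mul, one_mul]; exact hl _ _
    have hlog : Real.log (a k / C) ≤ k * hsub.lim := by
      obtain rfl | hk := Nat.eq_zero_or_pos k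
      · have h0 : a 0 ≤ C := by
          have := hl 0 0
          simp only [add_zero] at this
          exact le_of_mul_le_mul_right this (ha0 0)
        simpa using Real.log_nonpos (div_pos (ha0 0) hC0).le ((div_le_one hC0).2 h0)
      have hlim := ((hsub.tendsto_lim hbdd).comp
        (Filter.tendsto_id.atTop_mul_const' hk)).const_mul (k : ℝ)
      refine ge_of_tendsto hlim ?_
      filter_upwards [Filter.eventually_gt_atTop 0] with j hj
      have h1 := Real.log_le_log (pow_pos (div_pos (ha0 k) hC0) j) (hpow j)
      rw [Real.log_pow] at h1
      have hk' : (0 : ℝ) < k := by exact_mod_cast hk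
      have hj' : (0 : ℝ) < j := by exact_mod_cast hj
      simp only [Function.comp, id]
      push_cast
      rw [← mul_div_assoc, le_div_iff₀ (by positivity)]
      calc _ = k * (j * Real.log (a k / C)) := by ring
        _ ≤ _ := by gcongr
    rw [Real.log_le_iff_le_exp (div_pos (ha0 k) hC0), Real.exp_nat_mul, div_le_iff₀ hC0] at hlog
    linarith

lemma le_of_forall_pow_le_mul {x y C : ℝ} (hy : 0 < y)
    (h : ∀ k : ℕ, x ^ k ≤ C * y ^ k) : x ≤ y := by
  by_contra! hlt
  obtain ⟨n, hn⟩ := pow_unbounded_of_one_lt C ((one_lt_div hy).2 hlt)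
  have := h n
  rw [div_pow, lt_div_iff₀ (by positivity)] at hn
  linarith

lemma fib_add_one_le_goldenRatio_pow (n : ℕ) : (Nat.fib (n + 1) : ℝ) ≤ Real.goldenRatio ^ n := by
  rw [← Real.fib_succ_sub_goldenConj_mul_fib]
  nlinarith [Real.goldenConj_neg, (Nat.fib n).cast_nonneg (α := ℝ)]

lemma goldenRatio_pow_le_fib_add_two (n : ℕ) :
    Real.goldenRatio ^ n ≤ (Nat.fib (n + 2) : ℝ) := by
  rw [← Real.fib_succ_sub_goldenConj_mul_fib, Nat.fib_add_two]
  push_cast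
  nlinarith [Real.neg_one_lt_goldenConj, (Nat.fib n).cast_nonneg (α := ℝ)]

lemma exists_repPowSum_growth {p : ℕ} (hp : p ≠ 0) : ∃ L : ℝ, 0 < L ∧
    ∀ k, L ^ k ≤ 49 ^ p * repPowSum p k ∧ (repPowSum p k : ℝ) ≤ 49 ^ p * L ^ k := by
  refine exists_geometric_growth (one_le_pow₀ (by norm_num)) (fun k => ?_) (fun k m => ?_)
    (fun k m => ?_)
  · exact_mod_cast Nat.one_le_two_pow.trans (two_pow_le_repPowSum hp k)
  · exact_mod_cast (repPowSum_add hp k m).1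
  · exact_mod_cast (repPowSum_add hp k m).2

lemma repPowSum_le (p k : ℕ) (hp : p ≠ 0) :
    (repPowSum p k : ℝ) ^ 2 ≤
      (Real.goldenRatio ^ 4 * 64 ^ p) * (Real.goldenRatio ^ (p + 2)) ^ k := by
  have hφ := Real.goldenRatio_pos
  set s : ℝ := √(64 * Real.goldenRatio ^ k) with hs
  have hs2 : s ^ 2 = 64 * Real.goldenRatio ^ k := Real.sq_sqrt (by positivity)
  have h1 : (repPowSum p k : ℝ) ≤ Real.goldenRatio ^ (k + 2) * s ^ p := by
    rw [repPowSum_eq_sum hp]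
    push_cast
    calc _ ≤ ∑ n ∈ range (Nat.fib (k + 3)), s ^ p := by
          gcongr with n
          exact Real.le_sqrt_of_sq_le (rep_sq_le k n)
      _ = Nat.fib (k + 3) * s ^ p := by simp
      _ ≤ _ := by gcongr; exact fib_add_one_le_goldenRatio_pow (k + 2)
  calc _ ≤ (Real.goldenRatio ^ (k + 2) * s ^ p) ^ 2 := by gcongr
    _ = Real.goldenRatio ^ (2 * k + 4) * (s ^ 2) ^ p := by ring
    _ = _ := by
      rw [hs2]
      generalize Real.goldenRatio = φ
      simp only [mul_pow, ← pow_mul]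
      ring

lemma pow_le_repPowSum (p j : ℕ) (hp : p ≠ 0) :
    Real.goldenRatio ^ (2 * p * j) ≤ Real.goldenRatio ^ p * repPowSum p (4 * j) := by
  have hφ := Real.goldenRatio_pos
  obtain ⟨m, -, hm⟩ := exists_fib_le_rep j
  have h1 : Real.goldenRatio ^ (2 * j) ≤ Real.goldenRatio * Nat.fib (2 * j + 1) := by
    rw [← Real.fib_succ_sub_goldenConj_mul_fib, ← Real.one_sub_goldenConj]
    have : Nat.fib (2 * j) ≤ Nat.fib (2 * j + 1) := Nat.fib_le_fib_succ
    have : (Nat.fib (2 * j) : ℝ) ≤ Nat.fib (2 * j + 1) := by exact_mod_cast this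
    nlinarith [Real.goldenConj_neg, Real.one_sub_goldenConj]
  have h2 : (Nat.fib (2 * j + 1) ^ p : ℝ) ≤ repPowSum p (4 * j) := by
    exact_mod_cast (Nat.pow_le_pow_left hm p).trans (rep_pow_le_repPowSum hp _ _)
  calc _ = (Real.goldenRatio ^ (2 * j)) ^ p := by rw [← pow_mul]; congr 1; ring
    _ ≤ (Real.goldenRatio * Nat.fib (2 * j + 1)) ^ p := by gcongr
    _ = Real.goldenRatio ^ p * Nat.fib (2 * j + 1) ^ p := mul_pow _ _ _
    _ ≤ _ := by gcongr

lemma growth_bounds {p : ℕ} (hp : p ≠ 0) {L : ℝ} (hL : 0 < L)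
    (h : ∀ k, L ^ k ≤ 49 ^ p * repPowSum p k ∧ (repPowSum p k : ℝ) ≤ 49 ^ p * L ^ k) :
    2 ≤ L ∧ Real.goldenRatio ^ p ≤ L ^ 2 ∧ L ^ 2 ≤ Real.goldenRatio ^ (p + 2) := by
  have hφ := Real.goldenRatio_pos
  refine ⟨le_of_forall_pow_le_mul (C := 49 ^ p) hL fun k => ?_, ?_,
    le_of_forall_pow_le_mul (C := (49 ^ p) ^ 2 * (Real.goldenRatio ^ 4 * 64 ^ p))
      (by positivity) fun k => ?_⟩
  · refine le_trans ?_ (h k).2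
    exact_mod_cast two_pow_le_repPowSum hp k
  · have h4 : Real.goldenRatio ^ (2 * p) ≤ L ^ 4 :=
      le_of_forall_pow_le_mul (C := Real.goldenRatio ^ p * 49 ^ p) (by positivity)
        fun j => by
          calc _ = Real.goldenRatio ^ (2 * p * j) := by rw [← pow_mul]
            _ ≤ _ := pow_le_repPowSum p j hp
            _ ≤ Real.goldenRatio ^ p * (49 ^ p * L ^ (4 * j)) := by gcongr; exact (h _).2
            _ = _ := by rw [pow_mul]; ring
    refine (pow_le_pow_iff_left₀ (by positivity) (by positivity) two_ne_zero).1 ?_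
    calc _ = Real.goldenRatio ^ (2 * p) := by ring
      _ ≤ _ := h4
      _ = _ := by ring
  · calc _ = (L ^ k) ^ 2 := by ring
      _ ≤ (49 ^ p * repPowSum p k) ^ 2 := by gcongr; exact (h k).1
      _ = (49 ^ p) ^ 2 * (repPowSum p k : ℝ) ^ 2 := by ring
      _ ≤ (49 ^ p) ^ 2 *
          ((Real.goldenRatio ^ 4 * 64 ^ p) * (Real.goldenRatio ^ (p + 2)) ^ k) := by
        gcongr; exact repPowSum_le p k hp
      _ = _ := by ring

lemma SF_asymp {p : ℕ} (hp : p ≠ 0) {L : ℝ} (hL : 1 < L)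
    (h : ∀ k, L ^ k ≤ 49 ^ p * repPowSum p k ∧ (repPowSum p k : ℝ) ≤ 49 ^ p * L ^ k)
    {N : ℕ} (hN : 2 ≤ N) :
    (49 ^ p * L ^ 3)⁻¹ * (N : ℝ) ^ (Real.log L / Real.log Real.goldenRatio) ≤ SF p N ∧
      (SF p N : ℝ) ≤ 49 ^ p * L * (N : ℝ) ^ (Real.log L / Real.log Real.goldenRatio) := by
  have hφ := Real.goldenRatio_pos
  have hlog : 0 < Real.log Real.goldenRatio := Real.log_pos Real.one_lt_goldenRatio
  have hexp : 0 ≤ Real.log L / Real.log Real.goldenRatio :=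
    div_nonneg (Real.log_nonneg hL.le) hlog.le
  have hrpow : ∀ k : ℕ, (Real.goldenRatio ^ k) ^ (Real.log L / Real.log Real.goldenRatio) =
      L ^ k := fun k => by
    rw [← Real.rpow_natCast, ← Real.rpow_mul hφ.le, mul_comm, Real.rpow_mul hφ.le,
      Real.rpow_def_of_pos hφ, mul_div_cancel₀ _ hlog.ne', Real.exp_log (by linarith),
      Real.rpow_natCast]
  obtain ⟨k, hk⟩ : ∃ k, Nat.greatestFib N = k + 3 :=
    ⟨Nat.greatestFib N - 3, by have : 3 ≤ N.greatestFib := Nat.le_greatestFib.2 hN; omega⟩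
  have h1 : Nat.fib (k + 3) ≤ N := hk ▸ Nat.fib_greatestFib_le N
  have h2 : N < Nat.fib (k + 4) := by
    have := Nat.lt_fib_greatestFib_add_one N
    rwa [hk] at this
  have h3 : Real.goldenRatio ^ (k + 1) ≤ N :=
    (goldenRatio_pow_le_fib_add_two (k + 1)).trans (by exact_mod_cast h1)
  have h4 : (N : ℝ) ≤ Real.goldenRatio ^ (k + 3) :=
    le_trans (by exact_mod_cast h2.le) (fib_add_one_le_goldenRatio_pow (k + 3))
  have h5 := Real.rpow_le_rpow (by positivity) h3 hexp
  have h6 := Real.rpow_le_rpow (by positivity) h4 hexp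
  rw [hrpow] at h5 h6
  have h7 : (repPowSum p k : ℝ) ≤ SF p N := by exact_mod_cast repPowSum_le_SF hp h1
  have h8 : (SF p N : ℝ) ≤ repPowSum p (k + 2) := by exact_mod_cast SF_le_repPowSum hp h2.le
  constructor
  · rw [inv_mul_le_iff₀ (by positivity)]
    calc _ ≤ L ^ 3 * L ^ k := by rw [← pow_add, add_comm]; exact h6
      _ ≤ L ^ 3 * (49 ^ p * repPowSum p k) := by gcongr; exact (h k).1
      _ ≤ L ^ 3 * (49 ^ p * SF p N) := by gcongr
      _ = _ := by ring
  · calc _ ≤ _ := h8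
      _ ≤ 49 ^ p * L ^ (k + 2) := (h _).2
      _ = 49 ^ p * L * L ^ (k + 1) := by ring
      _ ≤ _ := by gcongr

theorem SF_asymp_and_lambda_limit :
    ∃ lam : ℕ → ℝ,
      (∀ p : ℕ, 1 ≤ p → 1 < lam p) ∧
      (∀ p : ℕ, 1 ≤ p →
        ∃ c C : ℝ, 0 < c ∧ c ≤ C ∧ ∃ N₀ : ℕ, ∀ N : ℕ, N₀ ≤ N →
          c * (N : ℝ) ^ (Real.log (lam p) / Real.log phi) ≤ (SF p N : ℝ) ∧
          (SF p N : ℝ) ≤ C * (N : ℝ) ^ (Real.log (lam p) / Real.log phi)) ∧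
      Filter.Tendsto (fun p : ℕ => (lam p) ^ (1 / (p : ℝ))) Filter.atTop
        (nhds (phi ^ ((1 : ℝ) / 2))) := by
  have hphi : phi = Real.goldenRatio := rfl
  rw [hphi]
  have hφ := Real.goldenRatio_pos
  choose! lam hpos hlam using fun p (hp : p ≠ 0) => exists_repPowSum_growth hp
  have hb : ∀ p, p ≠ 0 → _ := fun p hp => growth_bounds hp (hpos p hp) (hlam p hp)
  have hone : ∀ p : ℕ, 1 ≤ p → 1 < lam p := fun p hp => by
    linarith [(hb p (by omega)).1]
  refine ⟨lam, hone, fun p hp => ?_, ?_⟩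
  · have h1 := hone p hp
    have h49 : (1 : ℝ) ≤ 49 ^ p := one_le_pow₀ (by norm_num)
    refine ⟨(49 ^ p * lam p ^ 3)⁻¹, 49 ^ p * lam p, by positivity, ?_, 2, fun N hN =>
      SF_asymp (by omega) h1 (hlam p (by omega)) hN⟩
    exact (inv_le_one_of_one_le₀ (one_le_mul_of_one_le_of_one_le h49 (one_le_pow₀ h1.le))).trans
      (one_le_mul_of_one_le_of_one_le h49 h1.le)
  · have hroot : ∀ p : ℕ, p ≠ 0 →
        lam p ^ (1 / (p : ℝ)) = (lam p ^ 2) ^ (1 / (2 * p : ℝ)) := fun p hp => by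
      rw [← Real.rpow_natCast, ← Real.rpow_mul (hpos p hp).le]
      congr 1
      push_cast
      field_simp
    have hup : Filter.Tendsto (fun p : ℕ => Real.goldenRatio ^ ((1 : ℝ) / 2 + 1 / (p : ℝ)))
        Filter.atTop (nhds (Real.goldenRatio ^ ((1 : ℝ) / 2))) := by
      have h1 : Filter.Tendsto (fun p : ℕ => (1 : ℝ) / 2 + 1 / (p : ℝ)) Filter.atTop
          (nhds (1 / 2)) := by
        simpa using (tendsto_one_div_atTop_nhds_zero_nat (𝕜 := ℝ)).const_add (1 / 2 : ℝ)
      exact (Real.continuousAt_const_rpow hφ.ne').tendsto.comp h1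
    refine tendsto_of_tendsto_of_tendsto_of_le_of_le' tendsto_const_nhds hup ?_ ?_
    · filter_upwards [Filter.eventually_ne_atTop 0] with p hp
      rw [hroot p hp]
      calc _ = (Real.goldenRatio ^ p) ^ (1 / (2 * p : ℝ)) := by
            rw [← Real.rpow_natCast, ← Real.rpow_mul hφ.le]
            congr 1
            field_simp
        _ ≤ _ := Real.rpow_le_rpow (by positivity) (hb p hp).2.1 (by positivity)
    · filter_upwards [Filter.eventually_ne_atTop 0] with p hp
      rw [hroot p hp]
      calc _ ≤ (Real.goldenRatio ^ (p + 2)) ^ (1 / (2 * p : ℝ)) :=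
            Real.rpow_le_rpow (by positivity) (hb p hp).2.2 (by positivity)
        _ = _ := by
            rw [← Real.rpow_natCast, ← Real.rpow_mul hφ.le]
            congr 1
            push_cast
            field_simp
end
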